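/- Let n ≥ 2, q ≥ 5/3 and p ∈ ℝ. Every positive classical solution u of Δu + |∇u|^q u^p = 0 on all of ℝ^n is constant. -/

import Mathlib

open scoped BigOperators

/-- The Euclidean Laplacian of `u : ℝⁿ → ℝ`, defined as the sum of the second
partial derivatives in the coordinate directions. -/
noncomputable def elaplacian {n : ℕ} (u : EuclideanSpace ℝ (Fin n) → ℝ)
    (x : EuclideanSpace ℝ (Fin n)) : ℝ :=
  ∑ i : Fin n, fderiv ℝ (fun y => fderiv ℝ u y (EuclideanSpace.single i 1)) x
    (EuclideanSpace.single i 1)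

section

open Filter Topology InnerProductSpace Laplacian Asymptotics

section Laplacian

variable {E : Type*} [NormedAddCommGroup E] [InnerProductSpace ℝ E]

theorem laplacian_eq_sum_fderiv_fderiv [FiniteDimensional ℝ E] {ι : Type*} [Fintype ι]
    (b : OrthonormalBasis ι ℝ E) (f : E → ℝ) (x : E) :
    Δ f x = ∑ i, fderiv ℝ (fderiv ℝ f) x (b i) (b i) := by
  rw [congrFun (laplacian_eq_iteratedFDeriv_orthonormalBasis f b) x]
  simp [iteratedFDeriv_two_apply]

theorem fderiv_fderiv_apply_nonpos_of_isLocalMax {f : E → ℝ} {x : E} (hf : ContDiffAt ℝ 2 f x)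
    (hmax : IsLocalMax f x) (e : E) : fderiv ℝ (fderiv ℝ f) x e e ≤ 0 := by
  by_contra! hpos
  have hline : ∀ t : ℝ, HasDerivAt (fun t : ℝ => x + t • e) e t := fun t => by
    simpa using ((hasDerivAt_id t).smul_const e).const_add x
  have hcont : ContinuousAt (fun t : ℝ => x + t • e) 0 := (hline 0).continuousAt
  have h0 : x + (0 : ℝ) • e = x := by simp
  have hdiff : ∀ᶠ y in 𝓝 x, DifferentiableAt ℝ f y :=
    (hf.eventually (by simp)).mono fun y hy => hy.differentiableAt (by simp)
  have hdiff' : ∀ᶠ t in 𝓝 (0 : ℝ), DifferentiableAt ℝ f (x + t • e) := by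
    have hd : ∀ᶠ y in 𝓝 (x + (0 : ℝ) • e), DifferentiableAt ℝ f y := by rwa [h0]
    exact hcont.eventually hd
  have hd1 : ∀ᶠ t in 𝓝 (0 : ℝ), deriv (fun t : ℝ => f (x + t • e)) t
      = fderiv ℝ f (x + t • e) e :=
    hdiff'.mono fun t ht => (ht.hasFDerivAt.comp_hasDerivAt t (hline t)).deriv
  have hf' : DifferentiableAt ℝ (fderiv ℝ f) x :=
    (hf.fderiv_right (m := 1) (by norm_num)).differentiableAt (by simp)
  have hd2 : deriv (deriv (fun t : ℝ => f (x + t • e))) 0 = fderiv ℝ (fderiv ℝ f) x e e := by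
    rw [EventuallyEq.deriv_eq hd1]
    have h1 : HasDerivAt (fun t : ℝ => fderiv ℝ f (x + t • e)) (fderiv ℝ (fderiv ℝ f) x e) 0 := by
      have := hf'.hasFDerivAt
      rw [← h0] at this
      have := this.comp_hasDerivAt (0 : ℝ) (hline 0)
      rwa [h0] at this
    exact (((ContinuousLinearMap.apply ℝ ℝ e).hasFDerivAt).comp_hasDerivAt (0 : ℝ) h1).deriv
  have hmax' : IsLocalMax (fun t : ℝ => f (x + t • e)) 0 := by
    have hm : ∀ᶠ y in 𝓝 (x + (0 : ℝ) • e), f y ≤ f x := by rw [h0]; exact hmax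
    have := hcont.eventually hm
    simpa [IsLocalMax, IsMaxFilter] using this
  have hmin' := isLocalMin_of_deriv_deriv_pos (hd2 ▸ hpos) hmax'.deriv_eq_zero
    ((hdiff'.self_of_nhds.hasFDerivAt.comp_hasDerivAt 0 (hline 0)).continuousAt)
  have hconst : (fun t : ℝ => f (x + t • e)) =ᶠ[𝓝 0] fun _ => f (x + (0 : ℝ) • e) := by
    filter_upwards [hmax', hmin'] with t h1 h2 using le_antisymm h1 h2
  have hd0 : deriv (fun t : ℝ => f (x + t • e)) =ᶠ[𝓝 0] fun _ => 0 := by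
    have := hconst.deriv
    simpa using this
  have := hd0.deriv_eq
  rw [hd2] at this
  simp at this
  linarith

theorem laplacian_nonpos_of_isLocalMax [FiniteDimensional ℝ E] {f : E → ℝ} {x : E}
    (hf : ContDiffAt ℝ 2 f x) (hmax : IsLocalMax f x) : Δ f x ≤ 0 := by
  rw [laplacian_eq_sum_fderiv_fderiv (stdOrthonormalBasis ℝ E)]
  exact Finset.sum_nonpos fun i _ => fderiv_fderiv_apply_nonpos_of_isLocalMax hf hmax _

theorem laplacian_comp_add_right [FiniteDimensional ℝ E] (f : E → ℝ) (a x : E) :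
    Δ (fun y => f (y + a)) x = Δ f (x + a) := by
  rw [congrFun (laplacian_eq_iteratedFDeriv_stdOrthonormalBasis _) x,
    congrFun (laplacian_eq_iteratedFDeriv_stdOrthonormalBasis _) (x + a)]
  simp [iteratedFDeriv_comp_add_right]

theorem laplacian_const_mul [FiniteDimensional ℝ E] {f : E → ℝ} {x : E} (c : ℝ)
    (hf : ContDiffAt ℝ 2 f x) :
    Δ (fun y => c * f y) x = c * Δ f x := by
  exact laplacian_smul c hf

theorem hasFDerivAt_norm_sq_clm {F : Type*} [NormedAddCommGroup F] [InnerProductSpace ℝ F]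
    (T : E →L[ℝ] F) (x₀ x : E) :
    HasFDerivAt (fun y => ‖T (y - x₀)‖ ^ 2) ((2 : ℝ) • (innerSL ℝ (T (x - x₀))).comp T) x := by
  have h : HasFDerivAt (fun y => T (y - x₀)) T x :=
    T.hasFDerivAt.comp x ((hasFDerivAt_id x).sub_const x₀)
  convert h.norm_sq using 1
  rw [ofNat_smul_eq_nsmul]

theorem contDiff_norm_sq_clm {F : Type*} [NormedAddCommGroup F] [InnerProductSpace ℝ F]
    (T : E →L[ℝ] F) (x₀ : E) : ContDiff ℝ 2 (fun y => ‖T (y - x₀)‖ ^ 2) :=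
  (T.contDiff.comp (contDiff_id.sub contDiff_const)).norm_sq ℝ

theorem laplacian_norm_sq_clm [FiniteDimensional ℝ E]
    {F : Type*} [NormedAddCommGroup F] [InnerProductSpace ℝ F]
    {ι : Type*} [Fintype ι] (b : OrthonormalBasis ι ℝ E)
    (T : E →L[ℝ] F) (x₀ x : E) :
    Δ (fun y => ‖T (y - x₀)‖ ^ 2) x = 2 * ∑ i, ‖T (b i)‖ ^ 2 := by
  rw [laplacian_eq_sum_fderiv_fderiv b, Finset.mul_sum]
  refine Finset.sum_congr rfl fun i _ => ?_
  have h1 : fderiv ℝ (fun y => ‖T (y - x₀)‖ ^ 2)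
      = fun y => (2 : ℝ) • (innerSL ℝ (T (y - x₀))).comp T :=
    funext fun y => (hasFDerivAt_norm_sq_clm T x₀ y).fderiv
  have h2 : HasFDerivAt (fun y => (2 : ℝ) • (innerSL ℝ (T (y - x₀))).comp T)
      ((2 : ℝ) • (((ContinuousLinearMap.compL ℝ E F ℝ).flip T).comp
        ((innerSL ℝ (E := F)).comp T))) x := by
    have h : HasFDerivAt (fun y => T (y - x₀)) T x :=
      T.hasFDerivAt.comp x ((hasFDerivAt_id x).sub_const x₀)
    exact ((((ContinuousLinearMap.compL ℝ E F ℝ).flip T).comp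
        (innerSL ℝ (E := F))).hasFDerivAt.comp x h).const_smul (2 : ℝ)
  rw [h1, h2.fderiv]
  simp

end Laplacian

section WeakMax
variable {E : Type*} [NormedAddCommGroup E] [InnerProductSpace ℝ E]

theorem exists_fderiv_eq_slope_along {g : E → ℝ} {x ν : E} {h : ℝ} (hh : 0 < h)
    (hg : ∀ t ∈ Set.Icc 0 h, DifferentiableAt ℝ g (x + t • ν)) :
    ∃ t ∈ Set.Ioo 0 h, (g (x + h • ν) - g x) / h = fderiv ℝ g (x + t • ν) ν := by
  have hline : ∀ t : ℝ, HasDerivAt (fun t : ℝ => x + t • ν) ν t := fun t => by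
    simpa using ((hasDerivAt_id t).smul_const ν).const_add x
  have hd : ∀ t ∈ Set.Icc 0 h, HasDerivAt (fun t : ℝ => g (x + t • ν))
      (fderiv ℝ g (x + t • ν) ν) t := fun t ht =>
    (hg t ht).hasFDerivAt.comp_hasDerivAt t (hline t)
  obtain ⟨t, ht, hte⟩ := exists_hasDerivAt_eq_slope (fun t : ℝ => g (x + t • ν)) _ hh
    (fun t ht => (hd t ht).continuousAt.continuousWithinAt)
    (fun t ht => hd t (Set.Ioo_subset_Icc_self ht))
  exact ⟨t, ht, by simpa using hte.symm⟩

theorem fderiv_eq_zero_of_le_sq {g : E → ℝ} {x₀ : E}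
    (hmax : ∀ᶠ x in 𝓝 x₀, g x - g x₀ ≤ ‖x - x₀‖ ^ 2) {g' : E →L[ℝ] ℝ}
    (hg : HasFDerivAt g g' x₀) : g' = 0 := by
  have h1 : IsLocalMax (fun x => g x - ‖x - x₀‖ ^ 2) x₀ := by
    filter_upwards [hmax] with x hx
    simp
    linarith
  have h2 := hasFDerivAt_norm_sq_clm (ContinuousLinearMap.id ℝ E) x₀ x₀
  have h3 := h1.hasFDerivAt_eq_zero (hg.sub h2)
  simpa using h3

variable [FiniteDimensional ℝ E]

theorem ContDiffAt.continuousAt_laplacian {q : E → ℝ} {x : E} (hq : ContDiffAt ℝ 2 q x) :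
    ContinuousAt (Δ q) x := by
  have h : ContinuousAt (fderiv ℝ (fderiv ℝ q)) x :=
    ((hq.fderiv_right (m := 1) (by norm_num)).fderiv_right (m := 0) (by norm_num)).continuousAt
  rw [show Δ q = fun x => ∑ i, fderiv ℝ (fderiv ℝ q) x (stdOrthonormalBasis ℝ E i)
    (stdOrthonormalBasis ℝ E i) from
    funext (laplacian_eq_sum_fderiv_fderiv (stdOrthonormalBasis ℝ E) q)]
  exact tendsto_finsetSum _ fun i _ => (h.clm_apply continuousAt_const).clm_apply continuousAt_const

theorem laplacian_le_of_le_sq {v q : E → ℝ} {x₀ ν : E} {α : ℝ} (hv : ContDiff ℝ 2 v)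
    (hq : ContDiffAt ℝ 2 q x₀) (hf : ContDiffAt ℝ 1 (Δ v) x₀)
    (hmax : ∀ ε > 0, ∀ᶠ x in 𝓝 x₀,
      α * (fderiv ℝ v x ν - fderiv ℝ v x₀ ν) + (q x - q x₀) ≤ ε * ‖x - x₀‖ ^ 2) :
    α * fderiv ℝ (Δ v) x₀ ν + Δ q x₀ ≤ 0 := by
  by_contra! hpos
  set κ := α * fderiv ℝ (Δ v) x₀ ν + Δ q x₀ with hκ
  set N : ℝ := (Module.finrank ℝ E : ℝ) with hN
  have hN0 : 0 ≤ N := by positivity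
  set δ := κ / (8 * (N + 1)) with hδ
  have hδ0 : 0 < δ := by positivity
  have hδN : 4 * δ * N ≤ κ / 2 := by
    have : κ = 8 * δ * (N + 1) := by rw [hδ]; field_simp
    nlinarith
  have hfd : ContinuousAt (fun y => α * fderiv ℝ (Δ v) y ν) x₀ :=
    continuousAt_const.mul
      (((hf.fderiv_right (m := 0) (by norm_num)).continuousAt).clm_apply continuousAt_const)
  have e1 : ∀ᶠ y in 𝓝 x₀, α * fderiv ℝ (Δ v) x₀ ν - κ / 4 < α * fderiv ℝ (Δ v) y ν :=
    hfd.eventually_const_lt (by linarith)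
  have e2 : ∀ᶠ y in 𝓝 x₀, Δ q x₀ - κ / 4 < Δ q y :=
    hq.continuousAt_laplacian.eventually_const_lt (by linarith)
  have e3 : ∀ᶠ y in 𝓝 x₀, DifferentiableAt ℝ (Δ v) y :=
    (hf.eventually (by simp)).mono fun y hy => hy.differentiableAt (by simp)
  have e4 : ∀ᶠ y in 𝓝 x₀, ContDiffAt ℝ 2 q y := hq.eventually (by simp)
  obtain ⟨R, hR, hball⟩ := Metric.eventually_nhds_iff_ball.1
    (e1.and (e2.and (e3.and (e4.and (hmax δ hδ0)))))
  set r := R / 3 with hr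
  have hr0 : 0 < r := by positivity
  have hin : ∀ y, ‖y - x₀‖ ≤ 2 * r → y ∈ Metric.ball x₀ R := fun y hy => by
    rw [mem_ball_iff_norm]; linarith
  have hvd : Differentiable ℝ v := hv.differentiable (by simp)
  have hw : Continuous fun y => fderiv ℝ v y ν :=
    (hv.continuous_fderiv (by simp)).clm_apply continuous_const
  obtain ⟨η, hη, huc⟩ := Metric.uniformContinuousOn_iff.1
    ((isCompact_closedBall x₀ (2 * r)).uniformContinuousOn_of_continuous hw.continuousOn)
    (δ * r ^ 2 / (2 * (|α| + 1))) (by positivity)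
  obtain ⟨h, hh0, hhν⟩ : ∃ h > 0, h * ‖ν‖ < min r η := by
    refine ⟨min r η / (2 * (‖ν‖ + 1)), by positivity, ?_⟩
    have : 0 < min r η := by positivity
    rw [div_mul_eq_mul_div, div_lt_iff₀ (by positivity)]
    nlinarith [norm_nonneg ν]
  have hstep : ∀ t ∈ Set.Icc 0 h, ‖t • ν‖ < min r η := fun t ht => by
    rw [norm_smul, Real.norm_of_nonneg ht.1]
    exact (mul_le_mul_of_nonneg_right ht.2 (norm_nonneg _)).trans_lt hhν
  have hmem : ∀ y, ‖y - x₀‖ ≤ r → ∀ t ∈ Set.Icc 0 h, ‖y + t • ν - x₀‖ ≤ 2 * r := by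
    intro y hy t ht
    have h1 := hstep t ht
    have h2 := norm_add_le (y - x₀) (t • ν)
    rw [show y + t • ν - x₀ = y - x₀ + t • ν by abel]
    linarith [min_le_left r η]
  set W : E → ℝ := fun y => α * ((v (y + h • ν) - v y) / h) + q y - 2 * δ * ‖y - x₀‖ ^ 2 with hW
  have happrox : ∀ y, ‖y - x₀‖ ≤ r →
      |α * ((v (y + h • ν) - v y) / h) - α * fderiv ℝ v y ν| < δ * r ^ 2 / 2 := by
    intro y hy
    obtain ⟨t, ht, hte⟩ := exists_fderiv_eq_slope_along (x := y) (ν := ν) hh0 (fun t _ => hvd _)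
    have ht' := Set.Ioo_subset_Icc_self ht
    have := huc (y + t • ν) (mem_closedBall_iff_norm.2 (hmem y hy t ht')) y
      (by rw [mem_closedBall_iff_norm]; linarith)
      (by rw [dist_eq_norm, add_sub_cancel_left]; exact (hstep t ht').trans_le (min_le_right _ _))
    rw [hte, ← mul_sub, abs_mul]
    rw [Real.dist_eq, lt_div_iff₀ (by positivity)] at this
    nlinarith [abs_nonneg α, abs_nonneg (fderiv ℝ v (y + t • ν) ν - fderiv ℝ v y ν)]
  have hWcont : ContinuousOn W (Metric.closedBall x₀ r) := by
    have hqc : ContinuousOn q (Metric.closedBall x₀ r) := fun y hy =>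
      (hball y (hin y (by rw [mem_closedBall_iff_norm] at hy; linarith))).2.2.2.1.continuousAt
        |>.continuousWithinAt
    have hvc := hv.continuous
    refine ((Continuous.continuousOn ?_).add hqc).sub (Continuous.continuousOn ?_) <;> fun_prop
  obtain ⟨x₁, hx₁, hx₁max⟩ := (isCompact_closedBall x₀ r).exists_isMaxOn
    ⟨x₀, Metric.mem_closedBall_self hr0.le⟩ hWcont
  rw [mem_closedBall_iff_norm] at hx₁
  have hx₁lt : ‖x₁ - x₀‖ < r := by
    refine lt_of_le_of_ne hx₁ fun heq => ?_
    have h1 : W x₀ ≤ W x₁ := hx₁max (Metric.mem_closedBall_self hr0.le)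
    have h2 := abs_lt.1 (happrox x₁ hx₁)
    have h3 := abs_lt.1 (happrox x₀ (by simpa using hr0.le))
    have h4 := (hball x₁ (hin x₁ (by linarith))).2.2.2.2
    simp only [hW, sub_self, norm_zero, heq] at h1 h4
    nlinarith
  have hloc : IsLocalMax W x₁ := by
    refine hx₁max.isLocalMax ?_
    exact Metric.closedBall_mem_nhds_of_mem (by rwa [mem_ball_iff_norm])
  have hx₁b := hball x₁ (hin x₁ (by linarith))
  have hc1 : ContDiffAt ℝ 2 (fun y => v (y + h • ν)) x₁ :=
    (hv.comp (contDiff_id.add contDiff_const)).contDiffAt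
  have hc2 : ContDiffAt ℝ 2 v x₁ := hv.contDiffAt
  have hc3 : ContDiffAt ℝ 2 (fun y => v (y + h • ν) - v y) x₁ := hc1.sub hc2
  have hc4 : ContDiffAt ℝ 2 (fun y => α / h * (v (y + h • ν) - v y)) x₁ := contDiffAt_const.mul hc3
  have hc5 : ContDiffAt ℝ 2 (fun y => ‖ContinuousLinearMap.id ℝ E (y - x₀)‖ ^ 2) x₁ :=
    (contDiff_norm_sq_clm _ _).contDiffAt
  have hc6 : ContDiffAt ℝ 2
      (fun y => 2 * δ * ‖ContinuousLinearMap.id ℝ E (y - x₀)‖ ^ 2) x₁ := contDiffAt_const.mul hc5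
  have hWeq : W = (fun y => α / h * (v (y + h • ν) - v y)) + q
      - (fun y => 2 * δ * ‖ContinuousLinearMap.id ℝ E (y - x₀)‖ ^ 2) := by
    funext y
    simp only [hW, Pi.add_apply, Pi.sub_apply, ContinuousLinearMap.id_apply]
    ring
  have hlap : Δ W x₁ = α * ((Δ v (x₁ + h • ν) - Δ v x₁) / h) + Δ q x₁ - 4 * δ * N := by
    have hadd : ContDiffAt ℝ 2 ((fun y => α / h * (v (y + h • ν) - v y)) + q) x₁ :=
      hc4.add hx₁b.2.2.2.1
    rw [hWeq, hadd.laplacian_sub hc6, hc4.laplacian_add hx₁b.2.2.2.1,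
      laplacian_const_mul _ hc3, laplacian_const_mul _ hc5,
      laplacian_norm_sq_clm (stdOrthonormalBasis ℝ E)]
    have : Δ (fun y => v (y + h • ν) - v y) x₁ = Δ v (x₁ + h • ν) - Δ v x₁ := by
      have := hc1.laplacian_sub hc2
      rw [laplacian_comp_add_right] at this
      exact this
    rw [this]
    simp [hN]
    ring
  have hle : Δ W x₁ ≤ 0 := laplacian_nonpos_of_isLocalMax
    (by rw [hWeq]; exact (hc4.add hx₁b.2.2.2.1).sub hc6) hloc
  obtain ⟨t, ht, hte⟩ := exists_fderiv_eq_slope_along (g := Δ v) (x := x₁) (ν := ν) hh0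
    (fun t ht => (hball _ (hin _ (hmem x₁ hx₁ t ht))).2.2.1)
  have := (hball _ (hin _ (hmem x₁ hx₁ t (Set.Ioo_subset_Icc_self ht)))).1
  rw [hlap, hte] at hle
  linarith [hx₁b.2.1]

end WeakMax

section Profile

/-- `Φ` lies, up to `o(t²)`, above the parabola of slope `s` and second derivative `b` at `r`. -/
def LowerJet (Φ : ℝ → ℝ) (r s b : ℝ) : Prop :=
  ∀ ε > 0, ∀ᶠ t in 𝓝 (0 : ℝ), Φ r + s * t + b / 2 * t ^ 2 - ε * t ^ 2 ≤ Φ (r + t)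

theorem LowerJet.add {Φ Ψ : ℝ → ℝ} {r s b s' b' : ℝ} (h : LowerJet Φ r s b)
    (h' : LowerJet Ψ r s' b') : LowerJet (fun x => Φ x + Ψ x) r (s + s') (b + b') := by
  intro ε hε
  filter_upwards [h (ε / 2) (by positivity), h' (ε / 2) (by positivity)] with t h1 h2
  linarith

theorem lowerJet_of_line_le {Φ : ℝ → ℝ} {r s : ℝ} (h : ∀ᶠ t in 𝓝 (0 : ℝ), Φ r + s * t ≤ Φ (r + t)) :
    LowerJet Φ r s 0 := by
  intro ε hε
  filter_upwards [h] with t ht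
  nlinarith [mul_nonneg hε.le (sq_nonneg t)]

theorem LowerJet.congr {Φ Ψ : ℝ → ℝ} {r s b : ℝ} (h : LowerJet Φ r s b)
    (he : Φ =ᶠ[𝓝 r] Ψ) : LowerJet Ψ r s b := by
  intro ε hε
  have hc : Tendsto (fun t => r + t) (𝓝 (0 : ℝ)) (𝓝 r) := by
    have : ContinuousAt (fun t => r + t) (0 : ℝ) := by fun_prop
    simpa [ContinuousAt] using this
  filter_upwards [h ε hε, hc.eventually he] with t h1 h2
  rw [← h2, ← he.self_of_nhds]
  exact h1

theorem lowerJet_of_hasDerivAt {Φ s : ℝ → ℝ} {r b : ℝ} (h : ∀ᶠ x in 𝓝 r, HasDerivAt Φ (s x) x)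
    (hs : HasDerivAt s b r) : LowerJet Φ r (s r) b := by
  intro ε hε
  have hc : Tendsto (fun t => r + t) (𝓝 (0 : ℝ)) (𝓝 r) := by
    have : ContinuousAt (fun t => r + t) (0 : ℝ) := by fun_prop
    simpa [ContinuousAt] using this
  have hs' := hc.eventually ((hasDerivAt_iff_isLittleO.1 hs).def hε)
  obtain ⟨δ, hδ, hball⟩ := Metric.eventually_nhds_iff_ball.1 ((hc.eventually h).and hs')
  refine Metric.eventually_nhds_iff_ball.2 ⟨δ, hδ, fun t ht => ?_⟩
  have hsub : ∀ y ∈ Metric.closedBall (0 : ℝ) |t|, y ∈ Metric.ball (0 : ℝ) δ := fun y hy => by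
    simp at hy ht ⊢
    linarith
  have key := (convex_closedBall (0 : ℝ) |t|).norm_image_sub_le_of_norm_hasDerivWithin_le
    (f := fun y => Φ (r + y) - s r * y - b / 2 * y ^ 2)
    (f' := fun y => s (r + y) - s r - b * y) (C := ε * |t|) (x := 0) (y := t)
    (fun y hy => by
      have h1 := (hball y (hsub y hy)).1
      have h2 : HasDerivAt (fun y => r + y) 1 y := (hasDerivAt_id y).const_add r
      have h3 := h1.comp y h2
      have h4 := (h3.sub ((hasDerivAt_id y).const_mul (s r))).sub
        ((hasDerivAt_pow 2 y).const_mul (b / 2))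
      refine (h4.congr_deriv ?_).hasDerivWithinAt
      simp
      ring)
    (fun y hy => by
      have h1 := (hball y (hsub y hy)).2
      simp at h1 hy ⊢
      calc |s (r + y) - s r - b * y| = |s (r + y) - s r - y * b| := by rw [mul_comm b]
        _ ≤ ε * |y| := h1
        _ ≤ ε * |t| := by gcongr)
    (by simp) (by simp)
  simp at key
  have h5 := (abs_le.1 key).1
  have h6 : ε * |t| * |t| = ε * t ^ 2 := by rw [mul_assoc, ← sq, sq_abs]
  linarith

theorem lowerJet_mul_log {e h : ℝ} (hh : 0 ≤ h) (r : ℝ) :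
    LowerJet (fun r => e * Real.log (1 + h * Real.exp r)) r
      (e * (h * Real.exp r / (1 + h * Real.exp r)))
      (e * (h * Real.exp r / (1 + h * Real.exp r) *
        (1 - h * Real.exp r / (1 + h * Real.exp r)))) := by
  have hpos : ∀ x, 0 < 1 + h * Real.exp x := fun x => by positivity
  have hd : ∀ x, HasDerivAt (fun x => 1 + h * Real.exp x) (h * Real.exp x) x := fun x =>
    ((Real.hasDerivAt_exp x).const_mul h).const_add 1
  refine lowerJet_of_hasDerivAt (s := fun r => e * (h * Real.exp r / (1 + h * Real.exp r)))
    (Eventually.of_forall fun x => ((hd x).log (hpos x).ne').const_mul e) ?_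
  have := (((Real.hasDerivAt_exp r).const_mul h).div (hd r) (hpos r).ne').const_mul e
  refine this.congr_deriv ?_
  have := (hpos r).ne'
  field_simp

/-- A weight function for the gradient estimate: a bounded above function whose one-sided jets
satisfy the differential inequality that makes the Bernstein argument work. -/
structure IsProfile (m k N S d c : ℝ) (Φ : ℝ → ℝ) : Prop where
  continuous : Continuous Φ
  bddAbove : ∃ C, ∀ r, Φ r ≤ C
  jet : ∀ r, ∃ s b, LowerJet Φ r s b ∧ |s| ≤ S ∧ |b| ≤ S ∧ d ≤ 1 + (k - 1) * s ∧
    c * (1 + Real.exp r) ^ 2 ≤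
      (1 + (k - 1) * s) * (1 + Real.exp r - m * s / (1 + (k - 1) * s)) ^ 2 / N
        - m * (Real.exp r * (1 - s) - s + m * s ^ 2 / (1 + (k - 1) * s)
          - m * b / (1 + (k - 1) * s) ^ 2)

/-- A weight function of at most logarithmic growth in `exp r`, which becomes a profile after
subtracting a small multiple of its asymptotic growth. -/
structure IsBaseProfile (m k κ g S d : ℝ) (Φ : ℝ → ℝ) : Prop where
  continuous : Continuous Φ
  growth : ∃ C, ∀ r, Φ r ≤ C + κ * Real.log (1 + Real.exp r)
  jet : ∀ r, ∃ s b, LowerJet Φ r s b ∧ 0 ≤ b ∧ b ≤ S ∧ 0 ≤ s ∧ s ≤ κ ∧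
    κ * (g * Real.exp r / (1 + g * Real.exp r)) ≤ s ∧ d ≤ 1 + (k - 1) * s ∧
    (1 + m) * s ≤ Real.exp r * (1 + (k - 1) * s) ∧
    Real.exp r * (1 - s) - s + m * s ^ 2 / (1 + (k - 1) * s)
          - m * b / (1 + (k - 1) * s) ^ 2 ≤ 0

theorem isProfile_zero_of_nonpos {m k N : ℝ} (hm : m ≤ 0) :
    IsProfile m k N 0 1 (1 / N) (fun _ => 0) where
  continuous := continuous_const
  bddAbove := ⟨0, fun _ => le_rfl⟩
  jet r := by
    refine ⟨0, 0, lowerJet_of_line_le (by simp), by simp, by simp, by simp, ?_⟩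
    have : 0 ≤ -m * Real.exp r := mul_nonneg (by linarith) (Real.exp_pos r).le
    simp
    rw [inv_mul_eq_div]
    linarith

theorem quotient_error_le {m k κ S d τ s₀ b₀ σ ε : ℝ} (hm : 0 < m) (hκ : 0 < κ) (hS : 0 ≤ S)
    (hd : 0 < d) (hτ : 0 < τ) (hb0 : 0 ≤ b₀) (hbS : b₀ ≤ S)
    (hσ0 : 0 ≤ σ) (hσ : σ ≤ ε * (1 + τ)) (hs : κ * σ ≤ s₀)
    (hD₀ : d ≤ 1 + (k - 1) * s₀) (hD : d ≤ 1 + (k - 1) * (s₀ - κ * σ))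
    (hQ : τ * (1 - s₀) - s₀ + m * s₀ ^ 2 / (1 + (k - 1) * s₀)
      - m * b₀ / (1 + (k - 1) * s₀) ^ 2 ≤ 0) :
    τ * (1 - (s₀ - κ * σ)) - (s₀ - κ * σ)
      + m * (s₀ - κ * σ) ^ 2 / (1 + (k - 1) * (s₀ - κ * σ))
      - m * (b₀ - κ * (σ * (1 - σ))) / (1 + (k - 1) * (s₀ - κ * σ)) ^ 2
    ≤ ε * (1 + τ) ^ 2 * (κ + 2 * m * S * |k - 1| * κ / d ^ 3 + m * κ / d ^ 2) := by
  have hσκ : 0 ≤ κ * σ := by positivity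
  have hdiff : (1 + (k - 1) * (s₀ - κ * σ)) - (1 + (k - 1) * s₀) ≤ |k - 1| * κ * σ := by
    have := neg_abs_le (k - 1)
    nlinarith
  have hsD : (s₀ - κ * σ) * (1 + (k - 1) * s₀) ≤ s₀ * (1 + (k - 1) * (s₀ - κ * σ)) := by
    nlinarith
  set D₀ := 1 + (k - 1) * s₀
  set D := 1 + (k - 1) * (s₀ - κ * σ)
  have hD₀p : 0 < D₀ := by linarith
  have hDp : 0 < D := by linarith
  have h1 : (s₀ - κ * σ) ^ 2 / D ≤ s₀ ^ 2 / D₀ := by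
    rw [div_le_div_iff₀ hDp hD₀p]
    calc (s₀ - κ * σ) ^ 2 * D₀ = (s₀ - κ * σ) * ((s₀ - κ * σ) * D₀) := by ring
      _ ≤ (s₀ - κ * σ) * (s₀ * D) := mul_le_mul_of_nonneg_left hsD (by linarith)
      _ ≤ s₀ * (s₀ * D) := mul_le_mul_of_nonneg_right (by linarith)
          (mul_nonneg (by linarith) hDp.le)
      _ = s₀ ^ 2 * D := by ring
  clear_value D D₀
  have h2 : 1 / D₀ ^ 2 - 1 / D ^ 2 ≤ 2 * (|k - 1| * κ * σ) / d ^ 3 := by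
    have e : 1 / D₀ ^ 2 - 1 / D ^ 2 = (D - D₀) * ((1 / D₀ + 1 / D) * (1 / D * (1 / D₀))) := by
      field_simp
      ring
    have i1 : 1 / D₀ ≤ 1 / d := one_div_le_one_div_of_le hd hD₀
    have i2 : 1 / D ≤ 1 / d := one_div_le_one_div_of_le hd hD
    have i3 : 0 < 1 / D := by positivity
    have i4 : 0 < 1 / D₀ := by positivity
    rw [e]
    calc (D - D₀) * ((1 / D₀ + 1 / D) * (1 / D * (1 / D₀)))
        ≤ (|k - 1| * κ * σ) * ((1 / D₀ + 1 / D) * (1 / D * (1 / D₀))) := by gcongr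
      _ ≤ (|k - 1| * κ * σ) * ((1 / d + 1 / d) * (1 / d * (1 / d))) := by gcongr
      _ = _ := by field_simp; ring
  have h3 : κ * σ * (1 - σ) / D ^ 2 ≤ κ * σ / d ^ 2 := by
    have : κ * σ * (1 - σ) ≤ κ * σ := by nlinarith
    gcongr
  have h4 : b₀ * (1 / D₀ ^ 2 - 1 / D ^ 2) ≤ S * (2 * (|k - 1| * κ * σ) / d ^ 3) :=
    (mul_le_mul_of_nonneg_left h2 hb0).trans (mul_le_mul_of_nonneg_right hbS (by positivity))
  have e1 : m * (s₀ - κ * σ) ^ 2 / D = m * ((s₀ - κ * σ) ^ 2 / D) := by ring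
  have e2 : m * s₀ ^ 2 / D₀ = m * (s₀ ^ 2 / D₀) := by ring
  have e3 : m * (b₀ - κ * (σ * (1 - σ))) / D ^ 2
      = m * (b₀ * (1 / D ^ 2)) - m * (κ * σ * (1 - σ) / D ^ 2) := by field_simp
  have e4 : m * b₀ / D₀ ^ 2 = m * (b₀ * (1 / D₀ ^ 2)) := by field_simp
  rw [e1, e3]
  rw [e2, e4] at hQ
  have j1 := mul_le_mul_of_nonneg_left h1 hm.le
  have j3 := mul_le_mul_of_nonneg_left h3 hm.le
  have j4 := mul_le_mul_of_nonneg_left h4 hm.le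
  have hfin : κ * σ * (1 + τ) + m * (S * (2 * (|k - 1| * κ * σ) / d ^ 3)) + m * (κ * σ / d ^ 2)
      ≤ ε * (1 + τ) ^ 2 * (κ + 2 * m * S * |k - 1| * κ / d ^ 3 + m * κ / d ^ 2) := by
    have e : κ * σ * (1 + τ) + m * (S * (2 * (|k - 1| * κ * σ) / d ^ 3)) + m * (κ * σ / d ^ 2)
      = σ * (κ * (1 + τ) + (2 * m * S * |k - 1| * κ / d ^ 3 + m * κ / d ^ 2)) := by
      field_simp
      ring
    rw [e]
    set B := 2 * m * S * |k - 1| * κ / d ^ 3 + m * κ / d ^ 2 with hB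
    have hB0 : 0 ≤ B := by positivity
    calc σ * (κ * (1 + τ) + B) ≤ σ * ((1 + τ) * (κ + B)) := by
          gcongr
          nlinarith
      _ ≤ ε * (1 + τ) * ((1 + τ) * (κ + B)) := by gcongr
      _ = _ := by rw [hB]; ring
  linarith

theorem square_term_ge {m k d N τ s₀ x : ℝ} (hm : 0 < m) (hN : 0 < N) (hd : 0 < d)
    (hτ : 0 < τ) (hx : 0 ≤ x) (hD₀ : d ≤ 1 + (k - 1) * s₀) (hD : d ≤ 1 + (k - 1) * (s₀ - x))
    (hsτ : (1 + m) * s₀ ≤ τ * (1 + (k - 1) * s₀)) :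
    d / (N * (1 + m) ^ 2) * (1 + τ) ^ 2 ≤ (1 + (k - 1) * (s₀ - x))
      * (1 + τ - m * (s₀ - x) / (1 + (k - 1) * (s₀ - x))) ^ 2 / N := by
  have hsD : (s₀ - x) * (1 + (k - 1) * s₀) ≤ s₀ * (1 + (k - 1) * (s₀ - x)) := by linarith
  set D₀ := 1 + (k - 1) * s₀
  set D := 1 + (k - 1) * (s₀ - x)
  clear_value D D₀
  have hDp : 0 < D := by linarith
  have hD₀p : 0 < D₀ := by linarith
  have h5 : (s₀ - x) / D ≤ τ / (1 + m) := by
    calc (s₀ - x) / D ≤ s₀ / D₀ := by rwa [div_le_div_iff₀ hDp hD₀p]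
      _ ≤ τ / (1 + m) := by
        rw [div_le_div_iff₀ hD₀p (by positivity)]
        linarith
  have h4 : (1 + τ) / (1 + m) ≤ 1 + τ - m * (s₀ - x) / D := by
    have h6 : (1 + τ) / (1 + m) ≤ 1 + τ - m * (τ / (1 + m)) := by
      rw [div_le_iff₀ (by positivity), sub_mul, mul_assoc, div_mul_cancel₀ _ (by positivity)]
      linarith
    have h7 := mul_le_mul_of_nonneg_left h5 hm.le
    rw [mul_div_assoc]
    linarith
  calc d / (N * (1 + m) ^ 2) * (1 + τ) ^ 2 = d * ((1 + τ) / (1 + m)) ^ 2 / N := by field_simp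
    _ ≤ _ := by gcongr

theorem IsBaseProfile.exists_isProfile {m k κ g S d N : ℝ} {Φ₀ : ℝ → ℝ} (hm : 0 < m)
    (hκ : 0 < κ) (hg : 0 < g) (hS : 0 ≤ S) (hd : 0 < d) (hd1 : d ≤ 1) (hN : 0 < N)
    (h : IsBaseProfile m k κ g S d Φ₀) :
    ∃ S d c, 0 < d ∧ 0 < c ∧ ∃ Φ, IsProfile m k N S d c Φ := by
  set C₁ := κ + 2 * m * S * |k - 1| * κ / d ^ 3 + m * κ / d ^ 2 with hC₁
  have hC₁0 : 0 < C₁ := by positivity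
  set c := d / (2 * N * (1 + m) ^ 2) with hc
  have hc0 : 0 < c := by positivity
  obtain ⟨ε, hε0, hεg, hε1, hεc⟩ : ∃ ε > 0, ε ≤ g ∧ ε ≤ 1 ∧ m * (ε * C₁) ≤ c := by
    refine ⟨min (min g 1) (c / (m * C₁)), by positivity, ?_, ?_, ?_⟩
    · exact (min_le_left _ _).trans (min_le_left _ _)
    · exact (min_le_left _ _).trans (min_le_right _ _)
    · have := min_le_right (min g 1) (c / (m * C₁))
      rw [le_div_iff₀ (by positivity)] at this
      linarith
  refine ⟨S + κ, d, c, hd, hc0,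
    fun r => Φ₀ r + -κ * Real.log (1 + ε * Real.exp r), ?_, ?_, ?_⟩
  · have : ∀ x, 1 + ε * Real.exp x ≠ 0 := fun x => by positivity
    exact h.continuous.add (continuous_const.mul (Continuous.log (by fun_prop) this))
  · obtain ⟨C, hC⟩ := h.growth
    refine ⟨C - κ * Real.log ε, fun r => ?_⟩
    have h1 : Real.log (ε * (1 + Real.exp r)) ≤ Real.log (1 + ε * Real.exp r) :=
      Real.log_le_log (by positivity) (by nlinarith [Real.exp_pos r])
    rw [Real.log_mul hε0.ne' (by positivity)] at h1
    have h2 := mul_le_mul_of_nonneg_left h1 hκ.le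
    linarith [hC r]
  · intro r
    obtain ⟨s₀, b₀, hj, hb0, hbS, hs0, hsκ, hsg, hDd, hsτ, hQ⟩ := h.jet r
    have hj' := hj.add (lowerJet_mul_log (e := -κ) hε0.le r)
    have hτ := Real.exp_pos r
    set τ := Real.exp r
    set σ := ε * τ / (1 + ε * τ) with hσ
    have hσ0 : 0 ≤ σ := by positivity
    have hσ1 : σ ≤ 1 := by
      rw [hσ, div_le_one (by positivity)]
      linarith
    have hσε : σ ≤ ε * (1 + τ) := by
      rw [hσ, div_le_iff₀ (by positivity)]
      have : 0 < ε * τ := by positivity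
      nlinarith
    have hσg : σ ≤ g * τ / (1 + g * τ) := by
      rw [hσ, div_le_div_iff₀ (by positivity) (by positivity)]
      nlinarith [mul_le_mul_of_nonneg_right hεg hτ.le]
    have hs : κ * σ ≤ s₀ := (mul_le_mul_of_nonneg_left hσg hκ.le).trans hsg
    have hκσ : 0 ≤ κ * σ := by positivity
    clear_value σ τ C₁ c
    have hD : d ≤ 1 + (k - 1) * (s₀ - κ * σ) := by
      rcases le_total k 1 with hk | hk
      · have := mul_nonneg (sub_nonneg.2 hk) hκσ
        linarith
      · have := mul_nonneg (sub_nonneg.2 hk) (sub_nonneg.2 hs)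
        linarith
    have hQ' := quotient_error_le hm hκ hS hd hτ hb0 hbS hσ0 hσε hs hDd hD hQ
    rw [← hC₁] at hQ'
    rw [show s₀ + -κ * σ = s₀ - κ * σ by ring,
      show b₀ + -κ * (σ * (1 - σ)) = b₀ - κ * (σ * (1 - σ)) by ring] at hj'
    refine ⟨_, _, hj', ?_, ?_, hD, ?_⟩
    · rw [abs_le]
      constructor <;> linarith
    · have h1 : κ * (σ * (1 - σ)) ≤ κ := by
        have h0 : σ * (1 - σ) ≤ 1 := by nlinarith
        simpa using mul_le_mul_of_nonneg_left h0 hκ.le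
      have h2 : 0 ≤ κ * (σ * (1 - σ)) := by
        have := sub_nonneg.2 hσ1
        positivity
      rw [abs_le]
      constructor <;> linarith
    · have h8 := square_term_ge hm hN hd hτ hκσ hDd hD hsτ
      have h9 := mul_le_mul_of_nonneg_left hQ' hm.le
      have h8' : d / (N * (1 + m) ^ 2) * (1 + τ) ^ 2 = 2 * c * (1 + τ) ^ 2 := by
        rw [hc]
        field_simp
      have h10 : m * (ε * (1 + τ) ^ 2 * C₁) ≤ c * (1 + τ) ^ 2 := by
        have := mul_le_mul_of_nonneg_right hεc (sq_nonneg (1 + τ))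
        linarith
      rw [h8'] at h8
      refine le_trans ?_ (sub_le_sub h8 (h9.trans h10))
      linarith
end Profile

section Profile

theorem quotient_nonpos_of_le_one {m k a s y D : ℝ} (hm : 0 ≤ m) (hk : 1 / 2 ≤ k) (hk1 : k ≤ 1)
    (ha : 0 ≤ a) (ham : a * (1 + 2 * m) = 1) (hs : 0 ≤ s) (hy : 0 < y)
    (hDs : D = 1 + (k - 1) * s) (hDy : D = y + a * k * s) :
    (1 + m) * s / y * (1 - s) - s + m * s ^ 2 / D - m * (s * y) / D ^ 2 ≤ 0 := by
  have hD : 0 < D := by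
    have : 0 ≤ a * k * s := by positivity
    linarith
  have hy' : y = D - a * k * s := by linarith
  have e : (1 + m) * s / y * (1 - s) - s + m * s ^ 2 / D - m * (s * y) / D ^ 2
      = -(s * (m * a * (k * s) * ((2 * k - 1) * (s * D) + a * (k * s) * D
        + a * (k * s) * ((1 - k) * s)))) / (D ^ 2 * y) := by
    field_simp
    rw [hy', hDs]
    have : m = (1 - a) / (2 * a) := by
      have : a ≠ 0 := by
        rintro rfl
        simp at ham
      field_simp
      linarith
    have ha0 : a ≠ 0 := by
      rintro rfl
      simp at ham
    rw [this]
    field_simp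
    ring
  rw [e]
  apply div_nonpos_of_nonpos_of_nonneg _ (by positivity)
  have h1 : 0 ≤ 2 * k - 1 := by linarith
  have h2 : 0 ≤ 1 - k := by linarith
  have h3 : 0 ≤ k := by linarith
  rw [neg_nonpos]
  positivity

theorem exists_isBaseProfile_of_le_one {m k : ℝ} (hm : 0 < m) (hk : 1 / 2 ≤ k) (hk1 : k ≤ 1) :
    ∃ κ g S d Φ, 0 < κ ∧ 0 < g ∧ 0 ≤ S ∧ 0 < d ∧ d ≤ 1 ∧ IsBaseProfile m k κ g S d Φ := by
  obtain ⟨a, ha, ham⟩ : ∃ a > 0, a * (1 + 2 * m) = 1 :=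
    ⟨1 / (1 + 2 * m), by positivity, by field_simp⟩
  have ha1 : a ≤ 1 := by nlinarith
  have hk0 : 0 < k := by linarith
  have hak : 0 < a * k := by positivity
  have hak1 : a * k ≤ k := by nlinarith
  obtain ⟨e, he, hek⟩ : ∃ e > 0, e * (a * k + 1 - k) = 1 := by
    have : 0 < a * k + 1 - k := by linarith
    exact ⟨1 / (a * k + 1 - k), by positivity, by field_simp⟩
  have he1 : 1 ≤ e := by nlinarith
  obtain ⟨h, hh, hhe⟩ : ∃ h > 0, (1 + m) * e * h = 1 :=
    ⟨1 / ((1 + m) * e), by positivity, by field_simp⟩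
  have hh1 : h ≤ 1 := by nlinarith [mul_pos hm he, mul_pos (mul_pos hm he) hh]
  refine ⟨e, h, e, a * k, fun r => e * Real.log (1 + h * Real.exp r), he, hh, he.le, hak,
    by linarith, ?_, ⟨0, fun r => ?_⟩, fun r => ?_⟩
  · have : ∀ x, 1 + h * Real.exp x ≠ 0 := fun x => by positivity
    exact continuous_const.mul (Continuous.log (by fun_prop) this)
  · rw [zero_add]
    gcongr
    nlinarith [Real.exp_pos r]
  · have hj := lowerJet_mul_log (e := e) hh.le r
    have hτ := Real.exp_pos r
    set τ := Real.exp r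
    set σ := h * τ / (1 + h * τ) with hσ
    have hσ0 : 0 ≤ σ := by positivity
    have hσ1 : 0 < 1 - σ := by
      have : 1 - σ = 1 / (1 + h * τ) := by
        rw [hσ]
        field_simp
        ring
      rw [this]
      positivity
    have hστ : σ = h * τ * (1 - σ) := by
      rw [hσ]
      field_simp
      ring
    clear_value σ τ
    have hτσ : τ * (1 - σ) = (1 + m) * (e * σ) := by
      linear_combination (-(1 - σ) * τ) * hhe - (1 + m) * e * hστ
    have hDy : 1 + (k - 1) * (e * σ) = 1 - σ + a * k * (e * σ) := by
      linear_combination (-σ) * hek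
    have hake : 0 ≤ a * k * (e * σ) := by positivity
    refine ⟨_, _, hj, by positivity, ?_, by positivity, ?_, le_rfl, ?_, ?_, ?_⟩
    · have : σ * (1 - σ) ≤ 1 := by nlinarith
      simpa using mul_le_mul_of_nonneg_left this he.le
    · nlinarith
    · rw [hDy]
      have : a * k * σ ≤ a * k * (e * σ) := by
        gcongr
        nlinarith
      nlinarith
    · rw [← hτσ, hDy]
      gcongr
      linarith
    · have := quotient_nonpos_of_le_one hm.le hk hk1 ha.le ham (s := e * σ)
          (by positivity) hσ1 rfl hDy
      rw [← hτσ, mul_div_assoc, div_self hσ1.ne', mul_one] at this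
      rwa [← mul_assoc e]

theorem exists_isBaseProfile_of_one_lt {m k : ℝ} (hm : 0 < m) (hk : 1 < k) :
    ∃ κ g S d Φ, 0 < κ ∧ 0 < g ∧ 0 ≤ S ∧ 0 < d ∧ d ≤ 1 ∧ IsBaseProfile m k κ g S d Φ := by
  have hk1 : 0 < k - 1 := by linarith
  have hk0 : 0 < k := by linarith
  obtain ⟨s₂, hs₂, hs₂k⟩ : ∃ s₂ : ℝ, 1 ≤ s₂ ∧ k * s₂ = k + m :=
    ⟨1 + m / k, by have : 0 < m / k := by positivity
                   linarith, by field_simp⟩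
  have hs₂p : 0 < s₂ := by linarith
  set D₂ := 1 + (k - 1) * s₂ with hD₂
  have hD₂p : 0 < D₂ := by positivity
  set τ₂ := (1 + m) * s₂ / D₂ with hτ₂
  have hτ₂p : 0 < τ₂ := by positivity
  have hτD₂ : τ₂ * D₂ = (1 + m) * s₂ := by rw [hτ₂]; field_simp
  set r₂ := Real.log τ₂
  have hr₂ : Real.exp r₂ = τ₂ := Real.exp_log hτ₂p
  set w : ℝ → ℝ := fun r => 1 + m - (k - 1) * Real.exp r with hw
  have hexp : ∀ r ≤ r₂, Real.exp r ≤ τ₂ := fun r hr => hr₂ ▸ Real.exp_le_exp.2 hr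
  have hwp : ∀ r ≤ r₂, 0 < w r := fun r hr => by
    have h1 := hexp r hr
    have h2 : 0 < 1 + m - (k - 1) * τ₂ := by
      have : (1 + m - (k - 1) * τ₂) * D₂ = 1 + m := by
        linear_combination (1 + m) * hD₂ - (k - 1) * hτD₂
      exact pos_of_mul_pos_left (by rw [this]; positivity) hD₂p.le
    simp only [hw]
    nlinarith
  set s : ℝ → ℝ := fun r => Real.exp r / w r with hs
  set φ : ℝ → ℝ := fun r => -(1 / (k - 1)) * Real.log (w r) with hφ
  have hwd : ∀ r, HasDerivAt w (-((k - 1) * Real.exp r)) r := fun r =>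
    ((Real.hasDerivAt_exp r).const_mul (k - 1)).const_sub (1 + m)
  have hφd : ∀ r ≤ r₂, HasDerivAt φ (s r) r := fun r hr => by
    refine (((hwd r).log (hwp r hr).ne').const_mul _).congr_deriv ?_
    have := (hwp r hr).ne'
    simp only [hs]
    field_simp
  have hsd : ∀ r ≤ r₂, HasDerivAt s (s r * (1 + (k - 1) * s r)) r := fun r hr => by
    refine ((Real.hasDerivAt_exp r).div (hwd r) (hwp r hr).ne').congr_deriv ?_
    have := (hwp r hr).ne'
    simp only [hs]
    field_simp
    ring
  have hs0 : ∀ r ≤ r₂, 0 ≤ s r := fun r hr => (div_pos (Real.exp_pos r) (hwp r hr)).le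
  have hss₂ : ∀ r ≤ r₂, s r ≤ s₂ := fun r hr => by
    simp only [hs]
    rw [div_le_iff₀ (hwp r hr)]
    simp only [hw]
    nlinarith [mul_le_mul_of_nonneg_right (hexp r hr) hD₂p.le]
  have hline : ∀ r ≤ r₂, φ r₂ + s₂ * (r - r₂) ≤ φ r := fun r hr => by
    rcases hr.eq_or_lt with rfl | hlt
    · simp
    obtain ⟨x, hx, hxe⟩ := exists_hasDerivAt_eq_slope φ s hlt
      (fun x hx => (hφd x hx.2).continuousAt.continuousWithinAt) (fun x hx => hφd x hx.2.le)
    have := hss₂ x hx.2.le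
    rw [hxe, div_le_iff₀ (sub_pos.2 hlt)] at this
    linarith
  have hmono : ∀ r ≤ r₂, φ r ≤ φ r₂ := fun r hr => by
    have h1 : w r₂ ≤ w r := by
      simp only [hw]
      have := Real.exp_le_exp.2 hr
      gcongr
    have h2 := Real.log_le_log (hwp r₂ le_rfl) h1
    simp only [hφ]
    have : 0 < 1 / (k - 1) := by positivity
    nlinarith
  set Φ : ℝ → ℝ := fun r => φ (min r r₂) + s₂ * max (r - r₂) 0 with hΦ
  have hΦ1 : ∀ r ≤ r₂, Φ r = φ r := fun r hr => by
    simp [hΦ, min_eq_left hr, max_eq_right (sub_nonpos.2 hr)]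
  have hΦ2 : ∀ r, r₂ ≤ r → Φ r = φ r₂ + s₂ * (r - r₂) := fun r hr => by
    simp [hΦ, min_eq_right hr, max_eq_left (sub_nonneg.2 hr)]
  refine ⟨s₂, 1 / ((1 + m) * s₂), s₂ * D₂, 1, Φ, hs₂p, by positivity, by positivity, one_pos,
    le_rfl, ?_, ?_, ?_⟩
  · refine Continuous.add (continuous_const.mul (Continuous.log ?_ fun r => ?_)) (by fun_prop)
    · simp only [hw]
      fun_prop
    · exact (hwp _ (min_le_right _ _)).ne'
  · refine ⟨φ r₂ + |s₂ * r₂|, fun r => ?_⟩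
    have hl : 0 ≤ Real.log (1 + Real.exp r) := Real.log_nonneg (by linarith [Real.exp_pos r])
    have hr : r ≤ Real.log (1 + Real.exp r) := by
      rw [Real.le_log_iff_exp_le (by positivity)]
      linarith
    rcases le_total r r₂ with h | h
    · rw [hΦ1 r h]
      have := hmono r h
      have := abs_nonneg (s₂ * r₂)
      have := mul_nonneg hs₂p.le hl
      linarith
    · rw [hΦ2 r h]
      have := neg_abs_le (s₂ * r₂)
      have := mul_le_mul_of_nonneg_left hr hs₂p.le
      linarith
  · intro r
    have hτ := Real.exp_pos r
    rcases lt_or_ge r r₂ with h | h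
    · have hj : LowerJet Φ r (s r) (s r * (1 + (k - 1) * s r)) := by
        refine (lowerJet_of_hasDerivAt (Φ := φ) ?_ (hsd r h.le)).congr ?_
        · filter_upwards [eventually_lt_nhds h] with x hx using hφd x hx.le
        · filter_upwards [eventually_lt_nhds h] with x hx using (hΦ1 x hx.le).symm
      have h0 := hs0 r h.le
      have h2 := hss₂ r h.le
      have hwr := hwp r h.le
      have hsw : s r * w r = Real.exp r := by
        simp only [hs]
        field_simp
      have hwr' : w r = 1 + m - (k - 1) * Real.exp r := rfl
      have hDp : 0 < 1 + (k - 1) * s r := by positivity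
      have hsτ : (1 + m) * s r = Real.exp r * (1 + (k - 1) * s r) := by
        rw [hwr'] at hsw
        linear_combination hsw
      refine ⟨_, _, hj, by positivity, ?_, h0, h2, ?_, ?_, hsτ.le, ?_⟩
      · rw [hD₂]
        gcongr
      · have e : s₂ * (1 / ((1 + m) * s₂) * Real.exp r / (1 + 1 / ((1 + m) * s₂) * Real.exp r))
            = (Real.exp r / (1 + m)) / (1 + 1 / ((1 + m) * s₂) * Real.exp r) := by
          field_simp
        rw [e]
        refine (div_le_self (by positivity) ?_).trans ?_
        · have : 0 < 1 / ((1 + m) * s₂) * Real.exp r := by positivity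
          linarith
        · rw [div_le_iff₀ (by positivity)]
          nlinarith [mul_nonneg h0 (mul_nonneg hk1.le hτ.le)]
      · have := mul_nonneg hk1.le h0
        linarith
      · have hτe : Real.exp r = (1 + m) * s r / (1 + (k - 1) * s r) := by
          rw [hsτ]
          field_simp
        rw [hτe]
        have : (1 + m) * s r / (1 + (k - 1) * s r) * (1 - s r) - s r
            + m * s r ^ 2 / (1 + (k - 1) * s r)
            - m * (s r * (1 + (k - 1) * s r)) / (1 + (k - 1) * s r) ^ 2
            = -(k * s r ^ 2 / (1 + (k - 1) * s r)) := by
          field_simp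
          ring
        rw [this, neg_nonpos]
        positivity
    · have hj : LowerJet Φ r s₂ 0 := by
        refine lowerJet_of_line_le (Eventually.of_forall fun t => ?_)
        rw [hΦ2 r h]
        rcases le_total (r + t) r₂ with h' | h'
        · rw [hΦ1 _ h']
          have := hline _ h'
          linarith
        · rw [hΦ2 _ h']
          linarith
      have hττ : τ₂ ≤ Real.exp r := hr₂ ▸ Real.exp_le_exp.2 h
      refine ⟨_, _, hj, le_rfl, by positivity, hs₂p.le, le_rfl, ?_, ?_, ?_, ?_⟩
      · have : 1 / ((1 + m) * s₂) * Real.exp r / (1 + 1 / ((1 + m) * s₂) * Real.exp r) ≤ 1 := by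
          rw [div_le_one (by positivity)]
          linarith
        simpa using mul_le_mul_of_nonneg_left this hs₂p.le
      · have := mul_nonneg hk1.le hs₂p.le
        linarith
      · rw [← hτD₂]
        gcongr
      · have h1 : Real.exp r * (1 - s₂) ≤ τ₂ * (1 - s₂) :=
          mul_le_mul_of_nonpos_right hττ (by linarith)
        have h2 : τ₂ * (1 - s₂) - s₂ + m * s₂ ^ 2 / D₂ = -(s₂ * k / D₂) := by
          rw [hτ₂]
          field_simp
          rw [hD₂]
          linear_combination (-1 : ℝ) * hs₂k
        have h3 : 0 ≤ s₂ * k / D₂ := by positivity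
        simp only [mul_zero, zero_div, sub_zero]
        linarith

theorem exists_isProfile (m : ℝ) {k N : ℝ} (hk : 1 / 2 ≤ k) (hN : 0 < N) :
    ∃ S d c, 0 < d ∧ 0 < c ∧ ∃ Φ, IsProfile m k N S d c Φ := by
  rcases le_or_gt m 0 with hm | hm
  · exact ⟨0, 1, 1 / N, one_pos, by positivity, _, isProfile_zero_of_nonpos hm⟩
  · obtain ⟨κ, g, S, d, Φ, hκ, hg, hS, hd, hd1, h⟩ :
        ∃ κ g S d Φ, 0 < κ ∧ 0 < g ∧ 0 ≤ S ∧ 0 < d ∧ d ≤ 1 ∧ IsBaseProfile m k κ g S d Φ := by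
      rcases le_or_gt k 1 with hk1 | hk1
      · exact exists_isBaseProfile_of_le_one hm hk hk1
      · exact exists_isBaseProfile_of_one_lt hm hk1
    exact h.exists_isProfile hm hκ hg hS hd hd1 hN

end Profile

section Jets

variable {E F : Type*} [NormedAddCommGroup E] [NormedSpace ℝ E]
  [NormedAddCommGroup F] [InnerProductSpace ℝ F]

theorem sq_norm_sub_isLittleO {G : E → F} {H : E →L[ℝ] F} {x₀ : E}
    (hG : HasFDerivAt G H x₀) :
    (fun x => ‖G x - G x₀‖ ^ 2 - ‖H (x - x₀)‖ ^ 2) =o[𝓝 x₀] fun x => ‖x - x₀‖ ^ 2 := by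
  have h1 : (fun x => G x - G x₀ - H (x - x₀)) =o[𝓝 x₀] fun x => ‖x - x₀‖ :=
    (hasFDerivAt_iff_isLittleO.1 hG).norm_right
  have h2 : (fun x => G x - G x₀ + H (x - x₀)) =O[𝓝 x₀] fun x => ‖x - x₀‖ :=
    (hG.isBigO_sub.add (H.isBigO_sub _ _)).norm_right
  have h3 : (fun x => ‖G x - G x₀ - H (x - x₀)‖ * ‖G x - G x₀ + H (x - x₀)‖) =o[𝓝 x₀]
      fun x => ‖x - x₀‖ * ‖x - x₀‖ := h1.norm_left.mul_isBigO h2.norm_left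
  simp only [sq]
  refine IsBigO.trans_isLittleO (IsBigO.of_bound 1 (Eventually.of_forall fun x => ?_)) h3
  rw [one_mul, Real.norm_eq_abs, Real.norm_of_nonneg (by positivity)]
  have h4 : ‖G x - G x₀‖ * ‖G x - G x₀‖ - ‖H (x - x₀)‖ * ‖H (x - x₀)‖
      = inner ℝ (G x - G x₀ - H (x - x₀)) (G x - G x₀ + H (x - x₀)) := by
    generalize G x - G x₀ = a
    generalize H (x - x₀) = b
    rw [inner_add_right, inner_sub_left, inner_sub_left, real_inner_self_eq_norm_mul_norm,
      real_inner_self_eq_norm_mul_norm, real_inner_comm a b]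
    ring
  rw [h4]
  exact abs_real_inner_le_norm _ _

theorem log_one_add_isLittleO :
    (fun y : ℝ => Real.log (1 + y) - (y - y ^ 2 / 2)) =o[𝓝 0] fun y => y ^ 2 := by
  have h1 : (fun y : ℝ => Real.log (1 + y) - (y - y ^ 2 / 2)) =O[𝓝 0] fun y => y ^ 3 := by
    refine IsBigO.of_bound 2 ?_
    filter_upwards [Metric.ball_mem_nhds (0 : ℝ) (by norm_num : (0 : ℝ) < 1 / 2)] with y hy
    rw [mem_ball_zero_iff, Real.norm_eq_abs] at hy
    have h := Real.abs_log_sub_add_sum_range_le (x := -y) (by rw [abs_neg]; linarith) 2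
    simp only [Finset.sum_range_succ, Finset.sum_range_zero, abs_neg, sub_neg_eq_add] at h
    norm_num at h
    rw [Real.norm_eq_abs, norm_pow, Real.norm_eq_abs]
    calc |Real.log (1 + y) - (y - y ^ 2 / 2)| = |-y + y ^ 2 / 2 + Real.log (1 + y)| := by
          congr 1
          ring
      _ ≤ |y| ^ 3 / (1 - |y|) := h
      _ ≤ 2 * |y| ^ 3 := by
          rw [div_le_iff₀ (by linarith)]
          have := pow_nonneg (abs_nonneg y) 3
          nlinarith
  refine h1.trans_isLittleO ?_
  exact isLittleO_pow_pow (by norm_num)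

theorem HasFDerivAt.log_norm {G : E → F} {H : E →L[ℝ] F} {x₀ : E}
    (hG : HasFDerivAt G H x₀) (hne : G x₀ ≠ 0) :
    HasFDerivAt (fun x => Real.log ‖G x‖)
      ((‖G x₀‖ ^ 2)⁻¹ • (innerSL ℝ (G x₀)).comp H) x₀ := by
  have h0 : ‖G x₀‖ ^ 2 ≠ 0 := by simpa using hne
  have h1 := (hG.norm_sq.log h0).const_mul (1 / 2)
  have e : (fun x => Real.log ‖G x‖) = fun x => 1 / 2 * Real.log (‖G x‖ ^ 2) := by
    funext x
    rw [Real.log_pow]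
    push_cast
    ring
  rw [e]
  refine h1.congr_fderiv ?_
  ext y
  simp
  ring

theorem log_norm_sub_isLittleO {G : E → F} {H : E →L[ℝ] F} {x₀ : E}
    (hG : HasFDerivAt G H x₀) (hne : G x₀ ≠ 0) :
    (fun x => Real.log ‖G x‖ - Real.log ‖G x₀‖ - (inner ℝ (G x₀) (G x - G x₀) / ‖G x₀‖ ^ 2
      + ‖H (x - x₀)‖ ^ 2 / (2 * ‖G x₀‖ ^ 2) - (inner ℝ (G x₀) (H (x - x₀))) ^ 2 / ‖G x₀‖ ^ 4))
      =o[𝓝 x₀] fun x => ‖x - x₀‖ ^ 2 := by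
  set ξ := G x₀ with hξ
  have hA : 0 < ‖ξ‖ := norm_pos_iff.2 hne
  set A := ‖ξ‖ with hA'
  set y : E → ℝ := fun x => 2 * inner ℝ ξ (G x - ξ) / A ^ 2 + ‖G x - ξ‖ ^ 2 / A ^ 2 with hy
  have hGξ : ∀ x, ‖G x‖ ^ 2 = A ^ 2 * (1 + y x) := fun x => by
    have : G x = ξ + (G x - ξ) := by abel
    rw [this, norm_add_sq_real]
    simp only [hy, ← hA']
    field_simp
    ring
  have hlin : HasFDerivAt (fun x => inner ℝ ξ (G x)) ((innerSL ℝ ξ).comp H) x₀ :=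
    (innerSL ℝ ξ).hasFDerivAt.comp x₀ hG
  have hnb : (fun x => ‖x - x₀‖ ^ 2) =O[𝓝 x₀] fun x => ‖x - x₀‖ ^ 2 := isBigO_refl _ _
  have hδ : (fun x => ‖G x - ξ‖) =O[𝓝 x₀] fun x => ‖x - x₀‖ := hG.isBigO_sub.norm_norm
  have hδ2 : (fun x => ‖G x - ξ‖ ^ 2) =O[𝓝 x₀] fun x => ‖x - x₀‖ ^ 2 := hδ.pow 2
  have ht : Tendsto (fun x => ‖x - x₀‖) (𝓝 x₀) (𝓝 0) := by
    have : Continuous fun x => ‖x - x₀‖ := by fun_prop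
    simpa using this.tendsto x₀
  have h21 : (fun x => ‖x - x₀‖ ^ 2) =O[𝓝 x₀] fun x => ‖x - x₀‖ := by
    have h : (fun x : ℝ => x ^ 2) =o[𝓝 0] fun x : ℝ => x ^ 1 := isLittleO_pow_pow (by norm_num)
    exact (h.comp_tendsto ht).isBigO.congr (fun _ => rfl) fun x => pow_one _
  have hω : (fun x => inner ℝ ξ (G x - ξ)) =O[𝓝 x₀] fun x => ‖x - x₀‖ := by
    refine IsBigO.trans (IsBigO.of_bound A (Eventually.of_forall fun x => ?_)) hδ
    rw [norm_norm]
    exact abs_real_inner_le_norm _ _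
  have hyO : y =O[𝓝 x₀] fun x => ‖x - x₀‖ := by
    have h1 := (hω.const_mul_left (2 / A ^ 2)).add ((hδ2.trans h21).const_mul_left (1 / A ^ 2))
    refine h1.congr_left fun x => ?_
    simp only [hy]
    ring
  have hy0 : Tendsto y (𝓝 x₀) (𝓝 0) := hyO.trans_tendsto ht
  have h1 : (fun x => Real.log (1 + y x) - (y x - y x ^ 2 / 2)) =o[𝓝 x₀] fun x => ‖x - x₀‖ ^ 2 :=
    (log_one_add_isLittleO.comp_tendsto hy0).trans_isBigO (hyO.pow 2)
  have h2 := sq_norm_sub_isLittleO hG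
  have h3 : (fun x => (inner ℝ ξ (G x - ξ)) ^ 2 - (inner ℝ ξ (H (x - x₀))) ^ 2) =o[𝓝 x₀]
      fun x => ‖x - x₀‖ ^ 2 := by
    have := sq_norm_sub_isLittleO hlin
    simpa [Real.norm_eq_abs, sq_abs, ← hξ, inner_sub_right] using this
  have h4 : (fun x => y x ^ 2 - (2 * inner ℝ ξ (G x - ξ) / A ^ 2) ^ 2) =o[𝓝 x₀]
      fun x => ‖x - x₀‖ ^ 2 := by
    have i1 : (fun x => ‖G x - ξ‖ ^ 2 / A ^ 2 * (y x + 2 * inner ℝ ξ (G x - ξ) / A ^ 2))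
        =o[𝓝 x₀] fun x => ‖x - x₀‖ ^ 2 * 1 := by
      refine IsBigO.mul_isLittleO ?_ ?_
      · exact (hδ2.const_mul_left (1 / A ^ 2)).congr_left fun x => by ring
      · rw [isLittleO_one_iff]
        have i2 : (fun x => y x + 2 * inner ℝ ξ (G x - ξ) / A ^ 2) =O[𝓝 x₀] fun x => ‖x - x₀‖ :=
          hyO.add ((hω.const_mul_left (2 / A ^ 2)).congr_left fun x => by ring)
        exact i2.trans_tendsto ht
    simp only [mul_one] at i1
    refine i1.congr_left fun x => ?_
    simp only [hy]
    ring
  have h5 := (((h1.const_mul_left (1 / 2)).sub (h4.const_mul_left (1 / 4))).add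
    (h2.const_mul_left (1 / (2 * A ^ 2)))).sub (h3.const_mul_left (1 / A ^ 4))
  refine h5.congr' ?_ EventuallyEq.rfl
  filter_upwards [hy0.eventually_const_lt (show (-1 : ℝ) < 0 by norm_num)] with x hx
  have hlog : Real.log ‖G x‖ - Real.log A = 1 / 2 * Real.log (1 + y x) := by
    have e1 : 2 * Real.log ‖G x‖ = 2 * Real.log A + Real.log (1 + y x) := by
      have e2 := congrArg Real.log (hGξ x)
      rw [Real.log_mul (by positivity) (by linarith), Real.log_pow, Real.log_pow] at e2
      exact_mod_cast e2
    linarith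
  rw [hlog]
  have : A ≠ 0 := hA.ne'
  simp only [hy, ← hξ]
  field_simp
  ring

end Jets

section MaxPoint

variable {E : Type*} [NormedAddCommGroup E] [InnerProductSpace ℝ E]

theorem sum_norm_sq_ge [FiniteDimensional ℝ E] {H : E →L[ℝ] E}
    (hH : ∀ a b, inner ℝ (H a) b = inner ℝ (H b) a)
    {ν : E} (hν : ‖ν‖ = 1) (hdim : 2 ≤ Module.finrank ℝ E) :
    ∃ b : OrthonormalBasis (Fin (Module.finrank ℝ E)) ℝ E,
      2 * ‖H ν‖ ^ 2 - (inner ℝ (H ν) ν) ^ 2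
        + (∑ i, inner ℝ (H (b i)) (b i) - inner ℝ (H ν) ν) ^ 2 / ((Module.finrank ℝ E : ℝ) - 1)
        ≤ ∑ i, ‖H (b i)‖ ^ 2 := by
  classical
  set n := Module.finrank ℝ E with hn
  let i₀ : Fin n := ⟨0, by omega⟩
  obtain ⟨b, hb⟩ := Orthonormal.exists_orthonormalBasis_extension_of_card_eq (𝕜 := ℝ) (E := E)
    (ι := Fin n) (by simp [hn]) (v := fun _ => ν) (s := {i₀}) (by
      rw [orthonormal_subsingleton_iff]
      intro i
      exact hν)
  have hb0 : b i₀ = ν := hb i₀ rfl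
  refine ⟨b, ?_⟩
  have hsplit : ∀ f : Fin n → ℝ, ∑ i, f i = f i₀ + ∑ i ∈ Finset.univ.erase i₀, f i := fun f =>
    (Finset.add_sum_erase _ _ (Finset.mem_univ _)).symm
  have h1 : ∀ i ∈ Finset.univ.erase i₀,
      (inner ℝ (H ν) (b i)) ^ 2 + (inner ℝ (H (b i)) (b i)) ^ 2 ≤ ‖H (b i)‖ ^ 2 := by
    intro i hi
    rw [← b.sum_sq_inner_left (H (b i)), hsplit, hb0, hH (b i) ν]
    gcongr
    exact Finset.single_le_sum (f := fun j => (inner ℝ (H (b i)) (b j)) ^ 2)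
      (fun j _ => sq_nonneg _) hi
  have h2 := Finset.sum_le_sum h1
  rw [Finset.sum_add_distrib] at h2
  have h3 := b.sum_sq_inner_left (H ν)
  rw [hsplit, hb0] at h3
  have h4 := sq_sum_le_card_mul_sum_sq (s := Finset.univ.erase i₀)
    (f := fun i => inner ℝ (H (b i)) (b i))
  have hcard : ((Finset.univ.erase i₀).card : ℝ) = (n : ℝ) - 1 := by
    rw [Finset.card_erase_of_mem (Finset.mem_univ _), Finset.card_univ, Fintype.card_fin,
      Nat.cast_sub (by omega), Nat.cast_one]
  have hn1 : (0 : ℝ) < (n : ℝ) - 1 := by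
    have : (2 : ℝ) ≤ n := by exact_mod_cast hdim
    linarith
  rw [hcard, ← div_le_iff₀' hn1] at h4
  rw [hsplit (fun i => inner ℝ (H (b i)) (b i)), hsplit (fun i => ‖H (b i)‖ ^ 2), hb0,
    add_sub_cancel_left]
  linarith

variable [CompleteSpace E]

theorem ContDiff.contDiff_gradient [FiniteDimensional ℝ E] {v : E → ℝ} (hv : ContDiff ℝ 2 v) :
    ContDiff ℝ 1 (gradient v) := by
  have e : gradient v = fun x => ∑ i, fderiv ℝ v x (stdOrthonormalBasis ℝ E i) •
      stdOrthonormalBasis ℝ E i := by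
    funext x
    rw [← (stdOrthonormalBasis ℝ E).sum_repr' (gradient v x)]
    refine Finset.sum_congr rfl fun i _ => ?_
    rw [real_inner_comm, inner_gradient_left]
  rw [e]
  exact ContDiff.sum fun i _ =>
    ((hv.fderiv_right (m := 1) (by norm_num)).clm_apply contDiff_const).smul contDiff_const

theorem inner_fderiv_gradient {v : E → ℝ} (hv : ContDiff ℝ 2 v) {x₀ : E} {H : E →L[ℝ] E}
    (hH : HasFDerivAt (gradient v) H x₀) (a b : E) :
    inner ℝ (H a) b = fderiv ℝ (fderiv ℝ v) x₀ a b := by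
  have h1 : HasFDerivAt (fun x => inner ℝ b (gradient v x)) ((innerSL ℝ b).comp H) x₀ :=
    (innerSL ℝ b).hasFDerivAt.comp x₀ hH
  have hd : DifferentiableAt ℝ (fderiv ℝ v) x₀ :=
    (hv.fderiv_right (m := 1) (by norm_num)).differentiable (by simp) x₀
  have h2 : HasFDerivAt (fun x => fderiv ℝ v x b)
      ((ContinuousLinearMap.apply ℝ ℝ b).comp (fderiv ℝ (fderiv ℝ v) x₀)) x₀ :=
    (ContinuousLinearMap.apply ℝ ℝ b).hasFDerivAt.comp x₀ hd.hasFDerivAt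
  have e : (fun x => inner ℝ b (gradient v x)) = fun x => fderiv ℝ v x b := by
    funext x
    rw [real_inner_comm, inner_gradient_left]
  rw [e] at h1
  have := congrArg (fun L => L a) (h1.unique h2)
  simpa [real_inner_comm] using this

theorem inner_fderiv_gradient_comm {v : E → ℝ} (hv : ContDiff ℝ 2 v) {x₀ : E} {H : E →L[ℝ] E}
    (hH : HasFDerivAt (gradient v) H x₀) (a b : E) :
    inner ℝ (H a) b = inner ℝ (H b) a := by
  rw [inner_fderiv_gradient hv hH, inner_fderiv_gradient hv hH]
  exact hv.contDiffAt.isSymmSndFDerivAt (by simp) a b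

theorem second_order_expansion_le {v ζ : E → ℝ} {x₀ ξ : E} {H : E →L[ℝ] E} {Φ : ℝ → ℝ}
    {m k s b : ℝ} (hv : ContDiff ℝ 2 v) (hH : HasFDerivAt (gradient v) H x₀)
    (hξ : gradient v x₀ = ξ) (hne : ξ ≠ 0)
    (hj : LowerJet Φ (m * v x₀ + (k - 1) * Real.log ‖ξ‖) s b) (hD : 0 < 1 + (k - 1) * s)
    (hmax : IsLocalMax (fun x => Real.log ‖gradient v x‖
      + Φ (m * v x + (k - 1) * Real.log ‖gradient v x‖) + ζ x) x₀) :
    ∀ ε > 0, ∀ᶠ x in 𝓝 x₀,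
      (1 + (k - 1) * s) / ‖ξ‖ ^ 2 * (fderiv ℝ v x ξ - fderiv ℝ v x₀ ξ)
      + ((m * s) * (v x - v x₀) + (ζ x - ζ x₀)
        + (1 + (k - 1) * s) * (‖H (x - x₀)‖ ^ 2 / (2 * ‖ξ‖ ^ 2)
          - (inner ℝ ξ (H (x - x₀))) ^ 2 / ‖ξ‖ ^ 4)
        + b / 2 * (m * inner ℝ ξ (x - x₀)
          + (k - 1) * (inner ℝ ξ (H (x - x₀)) / ‖ξ‖ ^ 2)) ^ 2) ≤ ε * ‖x - x₀‖ ^ 2 := by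
  intro ε hε
  have hne' : gradient v x₀ ≠ 0 := by rwa [hξ]
  have hΛ := log_norm_sub_isLittleO hH hne'
  have hΛ' := hH.log_norm hne'
  rw [hξ] at hΛ hΛ'
  have hvd : HasFDerivAt v (innerSL ℝ ξ) x₀ := by
    have h := (hv.differentiable (by simp) x₀).hasFDerivAt
    refine h.congr_fderiv ?_
    ext y
    rw [← inner_gradient_left, hξ]
    rfl
  have hr := (hvd.const_mul m).add (hΛ'.const_mul (k - 1))
  set r : E → ℝ := (fun x => m * v x) + fun x => (k - 1) * Real.log ‖gradient v x‖ with hrdef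
  set P : E →L[ℝ] ℝ := m • innerSL ℝ ξ
    + (k - 1) • ((‖ξ‖ ^ 2)⁻¹ • (innerSL ℝ ξ).comp H) with hP
  have hPx : ∀ h, P h = m * inner ℝ ξ h + (k - 1) * (inner ℝ ξ (H h) / ‖ξ‖ ^ 2) := fun h => by
    simp only [hP, add_apply, smul_apply,
      ContinuousLinearMap.comp_apply, innerSL_apply_apply, smul_eq_mul]
    ring
  have hr2 := sq_norm_sub_isLittleO hr
  have hr0 : Tendsto (fun x => r x - r x₀) (𝓝 x₀) (𝓝 0) := by
    have h : ContinuousAt (fun x => r x - r x₀) x₀ := hr.continuousAt.sub continuousAt_const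
    simpa only [sub_self] using h.tendsto
  obtain ⟨K, hK, hKb⟩ := (hr.isBigO_sub.norm_norm.pow 2).exists_pos
  have hrx₀ : m * v x₀ + (k - 1) * Real.log ‖ξ‖ = r x₀ := by
    simp [hrdef, hξ]
  rw [hrx₀] at hj
  set D := 1 + (k - 1) * s with hDdef
  filter_upwards [hmax, hΛ.def (c := ε / (3 * D)) (by positivity),
    hr2.def (c := ε / (3 * (|b| + 1))) (by positivity), hKb.bound,
    hr0.eventually (hj (ε / (3 * K)) (by positivity))] with x h1 h2 h3 h4 h5
  rw [add_sub_cancel] at h5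
  have hinner : inner ℝ ξ (gradient v x - ξ) = fderiv ℝ v x ξ - fderiv ℝ v x₀ ξ := by
    rw [inner_sub_right, real_inner_comm, inner_gradient_left, ← inner_gradient_left (x := x₀), hξ]
  rw [hinner] at h2
  simp only [Real.norm_eq_abs, sq_abs, abs_pow, abs_norm] at h2 h3 h4
  rw [hPx] at h3
  rw [hξ] at h1
  have hrx : m * v x + (k - 1) * Real.log ‖gradient v x‖ = r x := rfl
  rw [hrx, hrx₀] at h1
  have hρ : r x - r x₀ = m * (v x - v x₀)
      + (k - 1) * (Real.log ‖gradient v x‖ - Real.log ‖ξ‖) := by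
    rw [← hrx, ← hrx₀]
    ring
  have h6 := mul_le_mul_of_nonneg_left (abs_le.1 h2).1 hD.le
  have h6' : D * -(ε / (3 * D) * ‖x - x₀‖ ^ 2) = -(ε / 3 * ‖x - x₀‖ ^ 2) := by
    field_simp
  have h7 : -(ε / 3 * ‖x - x₀‖ ^ 2) ≤ b / 2 * ((r x - r x₀) ^ 2 - (m * inner ℝ ξ (x - x₀)
      + (k - 1) * (inner ℝ ξ (H (x - x₀)) / ‖ξ‖ ^ 2)) ^ 2) := by
    refine (abs_le.1 ?_).1
    rw [abs_mul]
    calc |b / 2| * _ ≤ (|b| + 1) * (ε / (3 * (|b| + 1)) * ‖x - x₀‖ ^ 2) := by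
          refine mul_le_mul ?_ h3 (abs_nonneg _) (by positivity)
          rw [abs_div, abs_two]
          linarith [abs_nonneg b]
      _ = _ := by field_simp
  have h8 : ε / (3 * K) * (r x - r x₀) ^ 2 ≤ ε / 3 * ‖x - x₀‖ ^ 2 := by
    calc ε / (3 * K) * (r x - r x₀) ^ 2 ≤ ε / (3 * K) * (K * ‖x - x₀‖ ^ 2) := by gcongr
      _ = _ := by field_simp
  rw [h6'] at h6
  have h9 : s * (r x - r x₀) + (Real.log ‖gradient v x‖ - Real.log ‖ξ‖)
      = m * s * (v x - v x₀) + D * (Real.log ‖gradient v x‖ - Real.log ‖ξ‖) := by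
    rw [hρ, hDdef]
    ring
  have h10 : D / ‖ξ‖ ^ 2 * (fderiv ℝ v x ξ - fderiv ℝ v x₀ ξ)
      = D * ((fderiv ℝ v x ξ - fderiv ℝ v x₀ ξ) / ‖ξ‖ ^ 2) := by ring
  rw [h10]
  linarith

end MaxPoint

section SecondOrder

variable {E : Type*} [NormedAddCommGroup E] [InnerProductSpace ℝ E] [FiniteDimensional ℝ E]
  [CompleteSpace E]

theorem gradient_second_order_le {ι : Type*} [Fintype ι] (β : OrthonormalBasis ι ℝ E)
    {v ζ : E → ℝ} {x₀ ξ : E} {H : E →L[ℝ] E}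
    {Φ : ℝ → ℝ} {m k s b : ℝ} (hv : ContDiff ℝ 2 v) (hΔ : ContDiffAt ℝ 1 (Δ v) x₀)
    (hζ : ContDiffAt ℝ 2 ζ x₀) (hH : HasFDerivAt (gradient v) H x₀)
    (hξ : gradient v x₀ = ξ) (hne : ξ ≠ 0)
    (hj : LowerJet Φ (m * v x₀ + (k - 1) * Real.log ‖ξ‖) s b) (hD : 0 < 1 + (k - 1) * s)
    (hmax : IsLocalMax (fun x => Real.log ‖gradient v x‖
      + Φ (m * v x + (k - 1) * Real.log ‖gradient v x‖) + ζ x) x₀) :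
    H ξ = -(‖ξ‖ ^ 2 / (1 + (k - 1) * s)) • ((m * s) • ξ + gradient ζ x₀) ∧
    (1 + (k - 1) * s) / ‖ξ‖ ^ 2 * fderiv ℝ (Δ v) x₀ ξ + m * s * Δ v x₀ + Δ ζ x₀
      + (1 + (k - 1) * s) * ((∑ i, ‖H (β i)‖ ^ 2) / ‖ξ‖ ^ 2 - 2 * ‖H ξ‖ ^ 2 / ‖ξ‖ ^ 4)
      + b * ‖m • ξ + ((k - 1) / ‖ξ‖ ^ 2) • H ξ‖ ^ 2 ≤ 0 := by
  have hsymm := inner_fderiv_gradient_comm hv hH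
  have hA : 0 < ‖ξ‖ := norm_pos_iff.2 hne
  set D := 1 + (k - 1) * s with hDdef
  set A := ‖ξ‖ with hAdef
  let T : E →L[ℝ] ℝ := (innerSL ℝ ξ).comp H
  let P : E →L[ℝ] ℝ := m • innerSL ℝ ξ + ((k - 1) / A ^ 2) • T
  have hT : ∀ h, T h = inner ℝ (H ξ) h := fun h => by
    rw [hsymm, real_inner_comm]
    rfl
  have hP : ∀ h, P h = inner ℝ (m • ξ + ((k - 1) / A ^ 2) • H ξ) h := fun h => by
    rw [inner_add_left, inner_smul_left, inner_smul_left, ← hT]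
    rfl
  let Q : E → ℝ := fun x => D / (2 * A ^ 2) * ‖H (x - x₀)‖ ^ 2
    + -(D / A ^ 4) * ‖T (x - x₀)‖ ^ 2 + b / 2 * ‖P (x - x₀)‖ ^ 2
  have hcH : ContDiffAt ℝ 2 (fun x => D / (2 * A ^ 2) * ‖H (x - x₀)‖ ^ 2) x₀ :=
    contDiffAt_const.mul (contDiff_norm_sq_clm H x₀).contDiffAt
  have hcT : ContDiffAt ℝ 2 (fun x => -(D / A ^ 4) * ‖T (x - x₀)‖ ^ 2) x₀ :=
    contDiffAt_const.mul (contDiff_norm_sq_clm T x₀).contDiffAt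
  have hcP : ContDiffAt ℝ 2 (fun x => b / 2 * ‖P (x - x₀)‖ ^ 2) x₀ :=
    contDiffAt_const.mul (contDiff_norm_sq_clm P x₀).contDiffAt
  have hQ0 : HasFDerivAt Q (0 : E →L[ℝ] ℝ) x₀ := by
    have h := (((hasFDerivAt_norm_sq_clm H x₀ x₀).const_mul (D / (2 * A ^ 2))).add
      ((hasFDerivAt_norm_sq_clm T x₀ x₀).const_mul (-(D / A ^ 4)))).add
      ((hasFDerivAt_norm_sq_clm P x₀ x₀).const_mul (b / 2))
    refine h.congr_fderiv ?_
    simp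
  have hQΔ : Δ Q x₀ = D / A ^ 2 * ∑ i, ‖H (β i)‖ ^ 2 - 2 * D / A ^ 4 * ‖H ξ‖ ^ 2
      + b * ‖m • ξ + ((k - 1) / A ^ 2) • H ξ‖ ^ 2 := by
    have e1 : Δ Q x₀ = D / (2 * A ^ 2) * (2 * ∑ i, ‖H (β i)‖ ^ 2)
        + -(D / A ^ 4) * (2 * ∑ i, ‖T (β i)‖ ^ 2) + b / 2 * (2 * ∑ i, ‖P (β i)‖ ^ 2) := by
      rw [← laplacian_norm_sq_clm β H x₀ x₀, ← laplacian_norm_sq_clm β T x₀ x₀,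
        ← laplacian_norm_sq_clm β P x₀ x₀,
        ← laplacian_const_mul _ (contDiff_norm_sq_clm H x₀).contDiffAt,
        ← laplacian_const_mul _ (contDiff_norm_sq_clm T x₀).contDiffAt,
        ← laplacian_const_mul _ (contDiff_norm_sq_clm P x₀).contDiffAt,
        ← hcH.laplacian_add hcT]
      exact (hcH.add hcT).laplacian_add hcP
    have eT : ∑ i, ‖T (β i)‖ ^ 2 = ‖H ξ‖ ^ 2 := by
      simp only [hT, Real.norm_eq_abs, sq_abs]
      exact β.sum_sq_inner_left _
    have eP : ∑ i, ‖P (β i)‖ ^ 2 = ‖m • ξ + ((k - 1) / A ^ 2) • H ξ‖ ^ 2 := by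
      simp only [hP, Real.norm_eq_abs, sq_abs]
      exact β.sum_sq_inner_left _
    rw [e1, eT, eP]
    field_simp
    ring
  have hvζ : ContDiffAt ℝ 2 (fun x => m * s * v x + ζ x) x₀ :=
    (contDiffAt_const.mul hv.contDiffAt).add hζ
  have hQ2 : ContDiffAt ℝ 2 Q x₀ := (hcH.add hcT).add hcP
  have hexp : ∀ ε > 0, ∀ᶠ x in 𝓝 x₀, D / A ^ 2 * (fderiv ℝ v x ξ - fderiv ℝ v x₀ ξ)
      + ((m * s * v x + ζ x + Q x) - (m * s * v x₀ + ζ x₀ + Q x₀)) ≤ ε * ‖x - x₀‖ ^ 2 := by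
    intro ε hε
    filter_upwards [second_order_expansion_le hv hH hξ hne hj hD hmax ε hε] with x hx
    refine le_trans (le_of_eq ?_) hx
    have hTx : T (x - x₀) = inner ℝ ξ (H (x - x₀)) := rfl
    have hPx : P (x - x₀) = m * inner ℝ ξ (x - x₀)
        + (k - 1) * (inner ℝ ξ (H (x - x₀)) / A ^ 2) := by
      change m * inner ℝ ξ (x - x₀) + (k - 1) / A ^ 2 * inner ℝ ξ (H (x - x₀)) = _
      ring
    have hQx : Q x₀ = 0 := by simp [Q]
    rw [hQx]
    simp only [Q, Real.norm_eq_abs, sq_abs, hTx, hPx]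
    ring
  constructor
  · have hd : DifferentiableAt ℝ ζ x₀ := hζ.differentiableAt (by simp)
    have hfd : HasFDerivAt (fun x => fderiv ℝ v x ξ) T x₀ := by
      have h := (innerSL ℝ ξ).hasFDerivAt.comp x₀ hH
      refine h.congr_of_eventuallyEq (Eventually.of_forall fun x => ?_)
      change fderiv ℝ v x ξ = inner ℝ ξ (gradient v x)
      rw [← inner_gradient_left, real_inner_comm]
    have hg := (hfd.const_mul (D / A ^ 2)).add
      ((((hv.differentiable (by simp) x₀).hasFDerivAt.const_mul (m * s)).add hd.hasFDerivAt).add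
        hQ0)
    have h0 := fderiv_eq_zero_of_le_sq (x₀ := x₀) (by
      filter_upwards [hexp 1 one_pos] with x hx
      rw [one_mul] at hx
      refine le_trans (le_of_eq ?_) hx
      simp only [Pi.add_apply]
      ring) hg
    have h1 : ∀ h, D / A ^ 2 * inner ℝ (H ξ) h + m * s * inner ℝ ξ h
        + inner ℝ (gradient ζ x₀) h = 0 := fun h => by
      have h2 := congrArg (fun L => L h) h0
      simp only [add_apply, smul_apply, smul_eq_mul, hT, zero_apply, add_zero] at h2
      rw [← inner_gradient_left, ← inner_gradient_left, hξ] at h2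
      linarith
    refine ext_inner_right ℝ fun h => ?_
    rw [inner_smul_left, inner_add_left, inner_smul_left]
    have h2 := h1 h
    simp only [conj_trivial]
    field_simp
    field_simp at h2
    linarith
  · have h2 := laplacian_le_of_le_sq (q := fun x => m * s * v x + ζ x + Q x) hv
      (hvζ.add hQ2) hΔ hexp
    have e : Δ (fun x => m * s * v x + ζ x + Q x) x₀ = m * s * Δ v x₀ + Δ ζ x₀ + Δ Q x₀ := by
      rw [← laplacian_const_mul _ hv.contDiffAt,
        ← (contDiffAt_const.mul hv.contDiffAt).laplacian_add hζ]
      exact hvζ.laplacian_add hQ2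
    rw [e, hQΔ] at h2
    refine le_trans (le_of_eq ?_) h2
    ring

theorem laplacian_eq_sum_inner {ι : Type*} [Fintype ι] (β : OrthonormalBasis ι ℝ E)
    {v : E → ℝ} (hv : ContDiff ℝ 2 v) {x₀ : E} {H : E →L[ℝ] E}
    (hH : HasFDerivAt (gradient v) H x₀) : Δ v x₀ = ∑ i, inner ℝ (H (β i)) (β i) := by
  simp only [laplacian_eq_sum_fderiv_fderiv β, inner_fderiv_gradient hv hH]

theorem laplacian_regularity {v : E → ℝ} {x₀ ξ : E} {H : E →L[ℝ] E} {m k : ℝ}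
    (hv : ContDiff ℝ 2 v) (hH : HasFDerivAt (gradient v) H x₀)
    (heq : ∀ x, Δ v x = -‖gradient v x‖ ^ 2 - ‖gradient v x‖ ^ (k + 1) * Real.exp (m * v x))
    (hξ : gradient v x₀ = ξ) (hne : ξ ≠ 0) :
    ContDiffAt ℝ 1 (Δ v) x₀ ∧
    Δ v x₀ = -‖ξ‖ ^ 2 * (1 + Real.exp (m * v x₀ + (k - 1) * Real.log ‖ξ‖)) ∧
    fderiv ℝ (Δ v) x₀ ξ
      = -(2 + (k + 1) * Real.exp (m * v x₀ + (k - 1) * Real.log ‖ξ‖)) * inner ℝ (H ξ) ξ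
        - m * ‖ξ‖ ^ 4 * Real.exp (m * v x₀ + (k - 1) * Real.log ‖ξ‖) := by
  have hne' : gradient v x₀ ≠ 0 := by rwa [hξ]
  have hg := hv.contDiff_gradient
  have hpow : ∀ x, gradient v x ≠ 0 → ‖gradient v x‖ ^ (k + 1) * Real.exp (m * v x)
      = Real.exp ((k + 1) * Real.log ‖gradient v x‖ + m * v x) := fun x hx => by
    rw [Real.exp_add, Real.rpow_def_of_pos (norm_pos_iff.2 hx), mul_comm (Real.log _)]
  have hev : Δ v =ᶠ[𝓝 x₀] fun x => -‖gradient v x‖ ^ 2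
      - Real.exp ((k + 1) * Real.log ‖gradient v x‖ + m * v x) := by
    filter_upwards [hg.continuous.continuousAt.eventually_ne hne'] with x hx
    rw [heq, hpow x hx]
  have hτ : Real.exp ((k + 1) * Real.log ‖ξ‖ + m * v x₀)
      = ‖ξ‖ ^ 2 * Real.exp (m * v x₀ + (k - 1) * Real.log ‖ξ‖) := by
    have : ‖ξ‖ ^ 2 = Real.exp (2 * Real.log ‖ξ‖) := by
      rw [mul_comm, Real.exp_mul, Real.exp_log (norm_pos_iff.2 hne)]
      norm_cast
    rw [this, ← Real.exp_add]
    congr 1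
    ring
  refine ⟨?_, ?_, ?_⟩
  · refine ContDiffAt.congr_of_eventuallyEq ?_ hev
    have h1 : ContDiffAt ℝ 1 (fun x => ‖gradient v x‖) x₀ := hg.contDiffAt.norm ℝ hne'
    have h2 : ContDiffAt ℝ 1 (fun x => Real.log ‖gradient v x‖) x₀ :=
      h1.log (norm_ne_zero_iff.2 hne')
    exact (h1.pow 2).neg.sub ((contDiffAt_const.mul h2).add
      (contDiffAt_const.mul (hv.contDiffAt.of_le (by norm_num)))).exp
  · rw [hev.eq_of_nhds, hξ, hτ]
    ring
  · have hvd := (hv.differentiable (by simp) x₀).hasFDerivAt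
    have h1 := hH.norm_sq.neg.sub
      (((hH.log_norm hne').const_mul (k + 1)).add (hvd.const_mul m)).exp
    have h2 : fderiv ℝ (Δ v) x₀ = _ := hev.fderiv_eq.trans h1.fderiv
    rw [h2]
    have h3 : fderiv ℝ v x₀ ξ = ‖ξ‖ ^ 2 := by
      rw [← inner_gradient_left, hξ, real_inner_self_eq_norm_sq]
    have hA : ‖ξ‖ ≠ 0 := norm_ne_zero_iff.2 hne
    simp only [Pi.add_apply, sub_apply, neg_apply, smul_apply, add_apply,
      ContinuousLinearMap.comp_apply, innerSL_apply_apply, smul_eq_mul, hξ, h3, hτ,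
      real_inner_comm ξ (H ξ), two_smul]
    field_simp
    ring
end SecondOrder

theorem perturbed_profile_identity {m k N s b D τ γ G z : ℝ} (hD : D = 1 + (k - 1) * s)
    (hD0 : D ≠ 0) :
    (2 + (k + 1) * τ) * (m * s + γ) - m * D * τ - m * s * (1 + τ) + z
        - (m * s + γ) ^ 2 / D + D * (1 + τ - (m * s + γ) / D) ^ 2 / N
        + b * (m ^ 2 - 2 * m * (k - 1) * γ + (k - 1) ^ 2 * G ^ 2) / D ^ 2
      = (D * (1 + τ - m * s / D) ^ 2 / N
        - m * (τ * (1 - s) - s + m * s ^ 2 / D - m * b / D ^ 2)) + z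
        + ((2 + (k + 1) * τ) * γ - 2 * (m * s / D) * γ - γ ^ 2 / D
          - 2 * (1 + τ - m * s / D) * γ / N + γ ^ 2 / D / N
          - 2 * b * m * (k - 1) * γ / D ^ 2 + b * ((k - 1) ^ 2 * G ^ 2) / D ^ 2) := by
  have hmid : (2 + (k + 1) * τ) * (m * s + γ) - m * D * τ - m * s * (1 + τ)
      = -(m * (τ * (1 - s) - s)) + (2 + (k + 1) * τ) * γ := by
    rw [hD]
    ring
  have hsq : D * (1 + τ - (m * s + γ) / D) ^ 2
      = D * (1 + τ - m * s / D) ^ 2 - 2 * (1 + τ - m * s / D) * γ + γ ^ 2 / D := by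
    field_simp
    ring
  rw [hmid, hsq]
  ring

theorem profile_inequality_of_trace_inequality {m k N s b D τ γ G z A Q : ℝ} (hA : 0 < A)
    (hD : 0 < D)
    (hQ : 2 * (A ^ 4 / D ^ 2 * ((m * s) ^ 2 + 2 * (m * s) * γ + G ^ 2))
      - (-(A ^ 2 / D * (m * s + γ))) ^ 2
      + (-A ^ 2 * (1 + τ) - -(A ^ 2 / D * (m * s + γ))) ^ 2 / N ≤ Q)
    (hsec : D / A ^ 2 * (-(2 + (k + 1) * τ) * -(A ^ 4 / D * (m * s + γ)) - m * A ^ 4 * τ)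
      + m * s * (-A ^ 2 * (1 + τ)) + A ^ 2 * z
      + D * (Q / A ^ 2 - 2 * (A ^ 6 / D ^ 2 * ((m * s) ^ 2 + 2 * (m * s) * γ + G ^ 2)) / A ^ 4)
      + b * (A ^ 2 * (m ^ 2 - 2 * m * (k - 1) * γ + (k - 1) ^ 2 * G ^ 2) / D ^ 2) ≤ 0) :
    (2 + (k + 1) * τ) * (m * s + γ) - m * D * τ - m * s * (1 + τ) + z - (m * s + γ) ^ 2 / D
        + D * (1 + τ - (m * s + γ) / D) ^ 2 / N
        + b * (m ^ 2 - 2 * m * (k - 1) * γ + (k - 1) ^ 2 * G ^ 2) / D ^ 2 ≤ 0 := by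
  have h1 := mul_le_mul_of_nonneg_left hQ (by positivity : 0 ≤ D / A ^ 2)
  have e2 : D / A ^ 2 * (2 * (A ^ 4 / D ^ 2 * ((m * s) ^ 2 + 2 * (m * s) * γ + G ^ 2))
      - (-(A ^ 2 / D * (m * s + γ))) ^ 2
      + (-A ^ 2 * (1 + τ) - -(A ^ 2 / D * (m * s + γ))) ^ 2 / N)
      = A ^ 2 * (2 * ((m * s) ^ 2 + 2 * (m * s) * γ + G ^ 2) / D - (m * s + γ) ^ 2 / D
        + D * (1 + τ - (m * s + γ) / D) ^ 2 / N) := by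
    have e : -A ^ 2 * (1 + τ) - -(A ^ 2 / D * (m * s + γ))
        = -A ^ 2 * (1 + τ - (m * s + γ) / D) := by ring
    rw [e]
    field_simp
  have e3 : D / A ^ 2 * (-(2 + (k + 1) * τ) * -(A ^ 4 / D * (m * s + γ)) - m * A ^ 4 * τ)
      = A ^ 2 * ((2 + (k + 1) * τ) * (m * s + γ) - m * D * τ) := by
    field_simp
  have e4 : D * (Q / A ^ 2 - 2 * (A ^ 6 / D ^ 2 * ((m * s) ^ 2 + 2 * (m * s) * γ + G ^ 2)) / A ^ 4)
      = D / A ^ 2 * Q - A ^ 2 * (2 * ((m * s) ^ 2 + 2 * (m * s) * γ + G ^ 2) / D) := by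
    field_simp
  rw [e2] at h1
  rw [e3, e4] at hsec
  refine nonpos_of_mul_nonpos_right (a := A ^ 2) ?_ (by positivity)
  refine le_trans (le_of_eq ?_) (add_nonpos hsec (sub_nonpos.2 h1))
  ring

theorem exists_gradient_error_bound (m k : ℝ) {N S d c : ℝ} (hN : 0 < N) (hS : 0 ≤ S)
    (hd : 0 < d) (hc : 0 < c) :
    ∃ C, 0 ≤ C ∧ ∀ {s b D τ γ G z : ℝ}, D = 1 + (k - 1) * s → 0 ≤ τ → |γ| ≤ G → |s| ≤ S → |b| ≤ S →
      d ≤ D →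
      c * (1 + τ) ^ 2 ≤ D * (1 + τ - m * s / D) ^ 2 / N
        - m * (τ * (1 - s) - s + m * s ^ 2 / D - m * b / D ^ 2) →
      (2 + (k + 1) * τ) * (m * s + γ) - m * D * τ - m * s * (1 + τ) + z - (m * s + γ) ^ 2 / D
        + D * (1 + τ - (m * s + γ) / D) ^ 2 / N
        + b * (m ^ 2 - 2 * m * (k - 1) * γ + (k - 1) ^ 2 * G ^ 2) / D ^ 2 ≤ 0 →
      c / 2 ≤ -z + C * G ^ 2 := by
  obtain ⟨L, hL⟩ : ∃ L : ℝ, L = (2 + |k + 1|) + 2 * |m| * S / d + 2 * (1 + |m| * S / d) / N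
    + 2 * S * |m| * |k - 1| / d ^ 2 := ⟨_, rfl⟩
  obtain ⟨M, hM⟩ : ∃ M : ℝ, M = 1 / d + 1 / (d * N) + S * (k - 1) ^ 2 / d ^ 2 := ⟨_, rfl⟩
  have hL0 : 0 ≤ L := by rw [hL]; positivity
  have hM0 : 0 ≤ M := by rw [hM]; positivity
  refine ⟨L ^ 2 / (2 * c) + M, by positivity, ?_⟩
  intro s b D τ γ G z hDs hτ hγ hs hb hdD h1 h2
  have hD : 0 < D := hd.trans_le hdD
  have hG : 0 ≤ G := (abs_nonneg _).trans hγ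
  have hmsD : |m * s / D| ≤ |m| * S / d := by
    rw [abs_div, abs_mul, abs_of_pos hD]
    gcongr
  have hγ2 : γ ^ 2 ≤ G ^ 2 := sq_le_sq.2 (by rwa [abs_of_nonneg hG])
  have t1 : |(2 + (k + 1) * τ) * γ| ≤ (2 + |k + 1|) * ((1 + τ) * G) := by
    rw [abs_mul, ← mul_assoc]
    refine mul_le_mul ?_ hγ (abs_nonneg _) (by positivity)
    calc |2 + (k + 1) * τ| ≤ |2| + |(k + 1) * τ| := abs_add_le _ _
      _ = 2 + |k + 1| * τ := by rw [abs_mul, abs_of_nonneg hτ, abs_two]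
      _ ≤ (2 + |k + 1|) * (1 + τ) := by nlinarith [abs_nonneg (k + 1)]
  have hGτ : G ≤ (1 + τ) * G := by nlinarith
  have t2 : |2 * (m * s / D) * γ| ≤ 2 * |m| * S / d * ((1 + τ) * G) := by
    rw [abs_mul, abs_mul, abs_two]
    calc 2 * |m * s / D| * |γ| ≤ 2 * (|m| * S / d) * ((1 + τ) * G) := by
          gcongr
          exact hγ.trans hGτ
      _ = _ := by ring
  have t3 : |2 * (1 + τ - m * s / D) * γ / N| ≤ 2 * (1 + |m| * S / d) / N * ((1 + τ) * G) := by
    rw [abs_div, abs_mul, abs_mul, abs_two, abs_of_pos hN]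
    have : |1 + τ - m * s / D| ≤ (1 + |m| * S / d) * (1 + τ) := by
      calc |1 + τ - m * s / D| ≤ |1 + τ| + |m * s / D| := abs_sub _ _
        _ ≤ (1 + τ) + |m| * S / d := by rw [abs_of_nonneg (by positivity : 0 ≤ 1 + τ)]; gcongr
        _ ≤ _ := by
          have : 0 ≤ |m| * S / d * τ := by positivity
          linarith
    calc 2 * |1 + τ - m * s / D| * |γ| / N ≤ 2 * ((1 + |m| * S / d) * (1 + τ)) * G / N := by gcongr
      _ = _ := by ring
  have t4 : |2 * b * m * (k - 1) * γ / D ^ 2| ≤ 2 * S * |m| * |k - 1| / d ^ 2 * ((1 + τ) * G) := by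
    rw [abs_div, abs_mul, abs_mul, abs_mul, abs_mul, abs_two,
      abs_of_pos (by positivity : 0 < D ^ 2)]
    calc 2 * |b| * |m| * |k - 1| * |γ| / D ^ 2
          ≤ 2 * S * |m| * |k - 1| * ((1 + τ) * G) / d ^ 2 := by
          gcongr
          exact hγ.trans hGτ
      _ = _ := by ring
  have t5 : γ ^ 2 / D ≤ 1 / d * G ^ 2 := by
    calc γ ^ 2 / D ≤ G ^ 2 / d := by gcongr
      _ = _ := by ring
  have t6 : 0 ≤ γ ^ 2 / D / N := by positivity
  have t7 : |b * ((k - 1) ^ 2 * G ^ 2) / D ^ 2| ≤ S * (k - 1) ^ 2 / d ^ 2 * G ^ 2 := by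
    rw [abs_div, abs_mul, abs_of_nonneg (by positivity : 0 ≤ (k - 1) ^ 2 * G ^ 2),
      abs_of_pos (by positivity : 0 < D ^ 2)]
    calc |b| * ((k - 1) ^ 2 * G ^ 2) / D ^ 2 ≤ S * ((k - 1) ^ 2 * G ^ 2) / d ^ 2 := by gcongr
      _ = _ := by ring
  have t8 : 0 ≤ 1 / (d * N) * G ^ 2 := by positivity
  have hsum : c * (1 + τ) ^ 2 + z - L * ((1 + τ) * G) - M * G ^ 2 ≤ 0 := by
    have eL : L * ((1 + τ) * G) = (2 + |k + 1|) * ((1 + τ) * G)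
        + 2 * |m| * S / d * ((1 + τ) * G) + 2 * (1 + |m| * S / d) / N * ((1 + τ) * G)
        + 2 * S * |m| * |k - 1| / d ^ 2 * ((1 + τ) * G) := by rw [hL]; ring
    have eM : M * G ^ 2 = 1 / d * G ^ 2 + 1 / (d * N) * G ^ 2
        + S * (k - 1) ^ 2 / d ^ 2 * G ^ 2 := by rw [hM]; ring
    rw [perturbed_profile_identity hDs hD.ne'] at h2
    rw [eL, eM]
    linarith [(abs_le.1 t1).1, (abs_le.1 t2).2, (abs_le.1 t3).2, (abs_le.1 t4).2, (abs_le.1 t7).1]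
  have hyoung : L * ((1 + τ) * G) ≤ c / 2 * (1 + τ) ^ 2 + L ^ 2 / (2 * c) * G ^ 2 := by
    have : 0 ≤ (c * (1 + τ) - L * G) ^ 2 / (2 * c) := by positivity
    have e : (c * (1 + τ) - L * G) ^ 2 / (2 * c)
        = c / 2 * (1 + τ) ^ 2 + L ^ 2 / (2 * c) * G ^ 2 - L * ((1 + τ) * G) := by
      field_simp
      ring
    linarith
  have h3 : c / 2 ≤ c / 2 * (1 + τ) ^ 2 :=
    le_mul_of_one_le_right (by positivity) (one_le_pow₀ (by linarith))
  linarith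

section GradientBound

variable {E : Type*} [NormedAddCommGroup E] [InnerProductSpace ℝ E] [FiniteDimensional ℝ E]
  [CompleteSpace E]

theorem exists_norm_gradient_sq_le_of_isLocalMax (hdim : 2 ≤ Module.finrank ℝ E)
    {m k S d c : ℝ} {Φ : ℝ → ℝ} (hd : 0 < d) (hc : 0 < c)
    (hΦ : IsProfile m k ((Module.finrank ℝ E : ℝ) - 1) S d c Φ) :
    ∃ C, 0 ≤ C ∧ ∀ {v ζ : E → ℝ} {x₀ : E}, ContDiff ℝ 2 v →
      (∀ x, Δ v x = -‖gradient v x‖ ^ 2 - ‖gradient v x‖ ^ (k + 1) * Real.exp (m * v x)) →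
      gradient v x₀ ≠ 0 → ContDiffAt ℝ 2 ζ x₀ →
      IsLocalMax (fun x => Real.log ‖gradient v x‖
        + Φ (m * v x + (k - 1) * Real.log ‖gradient v x‖) + ζ x) x₀ →
      c / 2 * ‖gradient v x₀‖ ^ 2 ≤ -Δ ζ x₀ + C * ‖gradient ζ x₀‖ ^ 2 := by
  have hN : (0 : ℝ) < (Module.finrank ℝ E : ℝ) - 1 := by
    have : (2 : ℝ) ≤ Module.finrank ℝ E := by exact_mod_cast hdim
    linarith
  have hS : 0 ≤ S := by
    obtain ⟨s, b, -, hs, -⟩ := hΦ.jet 0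
    exact (abs_nonneg _).trans hs
  obtain ⟨C, hC0, hC⟩ := exists_gradient_error_bound m k hN hS hd hc
  refine ⟨C, hC0, ?_⟩
  intro v ζ x₀ hv heq hne hζ hmax
  obtain ⟨ξ, hξ⟩ : ∃ ξ, gradient v x₀ = ξ := ⟨_, rfl⟩
  obtain ⟨Z, hZ⟩ : ∃ Z, gradient ζ x₀ = Z := ⟨_, rfl⟩
  have hH := (hv.contDiff_gradient.differentiable (by simp) x₀).hasFDerivAt
  set H := fderiv ℝ (gradient v) x₀
  have hsymm := inner_fderiv_gradient_comm hv hH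
  rw [hξ] at hne
  obtain ⟨hreg, hΔv, hdΔ⟩ := laplacian_regularity hv hH heq hξ hne
  obtain ⟨s, b, hj, hs, hb, hdD, hprof⟩ := hΦ.jet (m * v x₀ + (k - 1) * Real.log ‖ξ‖)
  set τ := Real.exp (m * v x₀ + (k - 1) * Real.log ‖ξ‖) with hτ
  set A := ‖ξ‖ with hA
  have hApos : 0 < A := norm_pos_iff.2 hne
  have hνn : ‖A⁻¹ • ξ‖ = 1 := by
    rw [norm_smul, norm_inv, Real.norm_eq_abs, abs_of_pos hApos, ← hA, inv_mul_cancel₀ hApos.ne']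
  obtain ⟨β, hβ⟩ := sum_norm_sq_ge hsymm hνn hdim
  obtain ⟨hHξ, hsec⟩ := gradient_second_order_le β hv hreg hζ hH hξ hne hj (hd.trans_le hdD) hmax
  rw [← laplacian_eq_sum_inner β hv hH] at hβ
  obtain ⟨D, hD⟩ : ∃ D, D = 1 + (k - 1) * s := ⟨_, rfl⟩
  rw [← hD] at hHξ hsec hdD hprof
  have hDpos : 0 < D := hd.trans_le hdD
  rw [← hA] at hHξ hsec
  rw [hξ, hZ]
  rw [hZ] at hHξ
  obtain ⟨γ, hγ⟩ : ∃ γ, γ = inner ℝ Z ξ / A ^ 2 := ⟨_, rfl⟩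
  obtain ⟨G, hG⟩ : ∃ G, G = ‖Z‖ / A := ⟨_, rfl⟩
  obtain ⟨z, hz⟩ : ∃ z, z = Δ ζ x₀ / A ^ 2 := ⟨_, rfl⟩
  have eΔ : Δ ζ x₀ = A ^ 2 * z := by rw [hz]; field_simp
  have iZ : inner ℝ Z ξ = A ^ 2 * γ := by rw [hγ]; field_simp
  have nZ : ‖Z‖ = A * G := by rw [hG]; field_simp
  have iξ : inner ℝ ξ ξ = A ^ 2 := by rw [real_inner_self_eq_norm_sq]
  have eHξξ : inner ℝ (H ξ) ξ = -(A ^ 4 / D * (m * s + γ)) := by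
    rw [hHξ, inner_smul_left, inner_add_left, inner_smul_left, iZ, iξ]
    simp only [conj_trivial]
    ring
  have eHξ : ‖H ξ‖ ^ 2 = A ^ 6 / D ^ 2 * ((m * s) ^ 2 + 2 * (m * s) * γ + G ^ 2) := by
    rw [hHξ, norm_smul, mul_pow, norm_add_sq_real, norm_smul, inner_smul_left, real_inner_comm,
      iZ, nZ, ← hA]
    simp only [conj_trivial, Real.norm_eq_abs, mul_pow, sq_abs]
    ring
  have eP : ‖m • ξ + ((k - 1) / A ^ 2) • H ξ‖ ^ 2
      = A ^ 2 * (m ^ 2 - 2 * m * (k - 1) * γ + (k - 1) ^ 2 * G ^ 2) / D ^ 2 := by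
    rw [norm_add_sq_real, norm_smul, norm_smul, inner_smul_left, inner_smul_right,
      real_inner_comm, eHξξ, mul_pow, mul_pow, eHξ, ← hA]
    simp only [conj_trivial, Real.norm_eq_abs, sq_abs]
    field_simp
    rw [hD]
    ring
  have eν : inner ℝ (H (A⁻¹ • ξ)) (A⁻¹ • ξ) = -(A ^ 2 / D * (m * s + γ)) := by
    rw [map_smul, inner_smul_left, inner_smul_right, eHξξ]
    simp only [conj_trivial]
    field_simp
  have enν : ‖H (A⁻¹ • ξ)‖ ^ 2 = A ^ 4 / D ^ 2 * ((m * s) ^ 2 + 2 * (m * s) * γ + G ^ 2) := by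
    rw [map_smul, norm_smul, mul_pow, eHξ]
    simp only [Real.norm_eq_abs, sq_abs]
    field_simp
  have hγG : |γ| ≤ G := by
    rw [hγ, hG, abs_div, abs_of_pos (by positivity : 0 < A ^ 2), div_le_div_iff₀ (by positivity)
      hApos]
    calc |inner ℝ Z ξ| * A ≤ ‖Z‖ * A * A := by
          gcongr
          exact abs_real_inner_le_norm Z ξ
      _ = ‖Z‖ * A ^ 2 := by ring
  have hmain := hC (z := z) hD (Real.exp_pos _).le hγG hs hb hdD hprof (by
    rw [eν, enν, hΔv] at hβ
    rw [hdΔ, hΔv, eHξξ, eHξ, eP] at hsec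
    rw [eΔ] at hsec
    exact profile_inequality_of_trace_inequality hApos hDpos hβ hsec)
  have e1 : A ^ 2 * (c / 2) ≤ A ^ 2 * (-z + C * G ^ 2) := by gcongr
  rw [nZ, eΔ]
  linarith
end GradientBound

section Liouville

variable {E : Type*} [NormedAddCommGroup E] [InnerProductSpace ℝ E]

theorem gradient_log [CompleteSpace E] {f : E → ℝ} {x : E} (hf : DifferentiableAt ℝ f x)
    (hx : f x ≠ 0) : gradient (fun y => Real.log (f y)) x = (f x)⁻¹ • gradient f x := by
  refine ext_inner_right ℝ fun h => ?_
  rw [inner_gradient_left, inner_smul_left, inner_gradient_left, (hf.hasFDerivAt.log hx).fderiv]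
  rfl

variable [FiniteDimensional ℝ E]

theorem laplacian_log [CompleteSpace E] {f : E → ℝ} {x : E} (hf : ContDiffAt ℝ 2 f x)
    (hx : f x ≠ 0) :
    Δ (fun y => Real.log (f y)) x = Δ f x / f x - ‖gradient f x‖ ^ 2 / f x ^ 2 := by
  set β := stdOrthonormalBasis ℝ E
  have hd : ∀ᶠ y in 𝓝 x, DifferentiableAt ℝ f y :=
    (hf.eventually (by simp)).mono fun y hy => hy.differentiableAt (by simp)
  have h1 : fderiv ℝ (fun y => Real.log (f y)) =ᶠ[𝓝 x] fun y => (f y)⁻¹ • fderiv ℝ f y := by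
    filter_upwards [hd, hf.continuousAt.eventually_ne hx] with y hy hy0
    exact (hy.hasFDerivAt.log hy0).fderiv
  have h2 : HasFDerivAt (fderiv ℝ f) (fderiv ℝ (fderiv ℝ f) x) x :=
    ((hf.fderiv_right (m := 1) (by norm_num)).differentiableAt (by simp)).hasFDerivAt
  have h3 : HasFDerivAt (fun y => (f y)⁻¹) (-(f x ^ 2)⁻¹ • fderiv ℝ f x) x :=
    (hasDerivAt_inv hx).comp_hasFDerivAt x hd.self_of_nhds.hasFDerivAt
  have h4 := h1.fderiv_eq.trans (h3.smul h2).fderiv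
  have h5 : ‖gradient f x‖ ^ 2 = ∑ i, (fderiv ℝ f x (β i)) ^ 2 := by
    rw [← β.sum_sq_inner_left (gradient f x)]
    simp only [inner_gradient_left]
  rw [laplacian_eq_sum_fderiv_fderiv β, laplacian_eq_sum_fderiv_fderiv β, h4, h5, Finset.sum_div,
    Finset.sum_div, ← Finset.sum_sub_distrib]
  refine Finset.sum_congr rfl fun i _ => ?_
  simp only [add_apply, smul_apply, ContinuousLinearMap.smulRight_apply, smul_eq_mul]
  ring

theorem laplacian_log_cutoff_ge [CompleteSpace E] {a x : E} {R : ℝ} (hR : 0 < R)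
    (hx : 0 < 1 - ‖x - a‖ ^ 2 / R ^ 2) :
    ContDiffAt ℝ 2 (fun y => Real.log (1 - ‖y - a‖ ^ 2 / R ^ 2)) x ∧
    ‖gradient (fun y => Real.log (1 - ‖y - a‖ ^ 2 / R ^ 2)) x‖ ^ 2
      ≤ 4 / (R * (1 - ‖x - a‖ ^ 2 / R ^ 2)) ^ 2 ∧
    -Δ (fun y => Real.log (1 - ‖y - a‖ ^ 2 / R ^ 2 : ℝ)) x
      ≤ (2 * Module.finrank ℝ E + 4) / (R * (1 - ‖x - a‖ ^ 2 / R ^ 2)) ^ 2 := by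
  set T := ContinuousLinearMap.id ℝ E
  have hη : ContDiff ℝ 2 (fun y : E => 1 - ‖y - a‖ ^ 2 / R ^ 2) :=
    contDiff_const.sub ((contDiff_norm_sq_clm T a).div_const _)
  have hηd : HasFDerivAt (fun y : E => 1 - ‖y - a‖ ^ 2 / R ^ 2)
      (-((R ^ 2)⁻¹ • ((2 : ℝ) • (innerSL ℝ (T (x - a))).comp T))) x := by
    have := ((hasFDerivAt_norm_sq_clm T a x).const_mul (R ^ 2)⁻¹).const_sub 1
    simp only [div_eq_inv_mul]
    exact this
  have hgrad : gradient (fun y : E => 1 - ‖y - a‖ ^ 2 / R ^ 2) x = (-(2 / R ^ 2)) • (x - a) := by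
    refine ext_inner_right ℝ fun h => ?_
    rw [inner_gradient_left, hηd.fderiv, inner_smul_left]
    simp only [conj_trivial]
    change -((R ^ 2)⁻¹ * (2 * inner ℝ (x - a) h)) = _
    ring
  have hlap : Δ (fun y : E => (1 - ‖y - a‖ ^ 2 / R ^ 2 : ℝ)) x
      = -(2 * Module.finrank ℝ E / R ^ 2) := by
    have e : (fun y : E => 1 - ‖y - a‖ ^ 2 / R ^ 2)
        = (fun _ => (1 : ℝ)) - fun y => (R ^ 2)⁻¹ * ‖T (y - a)‖ ^ 2 := by
      funext y
      change _ = 1 - (R ^ 2)⁻¹ * ‖y - a‖ ^ 2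
      ring
    rw [e, contDiffAt_const.laplacian_sub
      (contDiffAt_const.mul (contDiff_norm_sq_clm T a).contDiffAt),
      laplacian_const_mul _ (contDiff_norm_sq_clm T a).contDiffAt,
      laplacian_norm_sq_clm (stdOrthonormalBasis ℝ E), laplacian_eq_sum_fderiv_fderiv
      (stdOrthonormalBasis ℝ E)]
    simp [T]
    ring
  have hle : ‖x - a‖ ^ 2 ≤ R ^ 2 := by
    rw [sub_pos, div_lt_one (by positivity)] at hx
    exact hx.le
  have hle1 : 1 - ‖x - a‖ ^ 2 / R ^ 2 ≤ 1 := by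
    have : 0 ≤ ‖x - a‖ ^ 2 / R ^ 2 := by positivity
    linarith
  have hnorm : ‖gradient (fun y : E => 1 - ‖y - a‖ ^ 2 / R ^ 2) x‖ ^ 2 ≤ 4 / R ^ 2 := by
    rw [hgrad, norm_smul, mul_pow, Real.norm_eq_abs, sq_abs]
    calc (-(2 / R ^ 2)) ^ 2 * ‖x - a‖ ^ 2 ≤ (-(2 / R ^ 2)) ^ 2 * R ^ 2 := by gcongr
      _ = 4 / R ^ 2 := by field_simp; norm_num
  refine ⟨hη.contDiffAt.log hx.ne', ?_, ?_⟩
  · rw [gradient_log (hη.differentiable (by simp) x) hx.ne', norm_smul, mul_pow, Real.norm_eq_abs,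
      sq_abs]
    set e := 1 - ‖x - a‖ ^ 2 / R ^ 2
    calc e⁻¹ ^ 2 * _ ≤ e⁻¹ ^ 2 * (4 / R ^ 2) := by gcongr
      _ = _ := by field_simp
  · rw [laplacian_log hη.contDiffAt hx.ne', hlap]
    set e := 1 - ‖x - a‖ ^ 2 / R ^ 2
    have h1 := div_le_div_of_nonneg_right hnorm (by positivity : 0 ≤ e ^ 2)
    have h2 : 2 * (Module.finrank ℝ E : ℝ) / R ^ 2 / e
        ≤ 2 * Module.finrank ℝ E / R ^ 2 / e ^ 2 := by
      gcongr
      nlinarith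
    calc _ = 2 * (Module.finrank ℝ E : ℝ) / R ^ 2 / e + _ / e ^ 2 := by ring
      _ ≤ 2 * (Module.finrank ℝ E : ℝ) / R ^ 2 / e ^ 2 + 4 / R ^ 2 / e ^ 2 := add_le_add h2 h1
      _ = _ := by field_simp

theorem exists_isMaxOn_cutoff [CompleteSpace E] {v : E → ℝ} {a : E} {R m k C : ℝ} {Φ : ℝ → ℝ}
    (hv : ContDiff ℝ 2 v) (hΦ : Continuous Φ) (hC : ∀ r, Φ r ≤ C) (ha : gradient v a ≠ 0)
    (hR : 0 < R) :
    ∃ x₀, gradient v x₀ ≠ 0 ∧ 0 < 1 - ‖x₀ - a‖ ^ 2 / R ^ 2 ∧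
      IsLocalMax (fun x => Real.log ‖gradient v x‖
        + Φ (m * v x + (k - 1) * Real.log ‖gradient v x‖)
        + Real.log (1 - ‖x - a‖ ^ 2 / R ^ 2)) x₀ ∧
      ‖gradient v a‖ * Real.exp (Φ (m * v a + (k - 1) * Real.log ‖gradient v a‖))
        ≤ Real.exp C * (‖gradient v x₀‖ * (1 - ‖x₀ - a‖ ^ 2 / R ^ 2)) := by
  have hg := hv.contDiff_gradient.continuous
  set η : E → ℝ := fun x => 1 - ‖x - a‖ ^ 2 / R ^ 2 with hη
  have hηc : Continuous η := by fun_prop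
  set F : E → ℝ := fun x => ‖gradient v x‖
    * Real.exp (Φ (m * v x + (k - 1) * Real.log ‖gradient v x‖)) with hF
  have hFC : ∀ x, F x ≤ Real.exp C * ‖gradient v x‖ := fun x => by
    rw [mul_comm]
    simp only [hF]
    gcongr
    exact hC _
  have hF0 : ∀ x, 0 ≤ F x := fun x => by positivity
  have hFa : 0 < F a := mul_pos (norm_pos_iff.2 ha) (Real.exp_pos _)
  have hη1 : ∀ x, η x ≤ 1 := fun x => by
    have : 0 ≤ ‖x - a‖ ^ 2 / R ^ 2 := by positivity
    simp only [hη]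
    linarith
  have hηa : η a = 1 := by simp [hη]
  set K : Set E := Metric.closedBall a R ∩ {x | F a ≤ Real.exp C * ‖gradient v x‖} with hK
  have hKc : IsCompact K := (isCompact_closedBall a R).inter_right
    (isClosed_le continuous_const (continuous_const.mul hg.norm))
  have haK : a ∈ K := ⟨Metric.mem_closedBall_self hR.le, hFC a⟩
  have hne : ∀ x ∈ K, gradient v x ≠ 0 := fun x hx h0 => by
    have : F a ≤ Real.exp C * ‖gradient v x‖ := hx.2
    rw [h0, norm_zero, mul_zero] at this
    linarith
  have hcont : ContinuousOn (fun x => η x * F x) K := by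
    have hlog : ContinuousOn (fun x => Real.log ‖gradient v x‖) K :=
      hg.norm.continuousOn.log fun x hx => norm_ne_zero_iff.2 (hne x hx)
    exact hηc.continuousOn.mul (hg.norm.continuousOn.mul (Real.continuous_exp.comp_continuousOn
      (hΦ.comp_continuousOn ((continuousOn_const.mul hv.continuous.continuousOn).add
        (continuousOn_const.mul hlog)))))
  obtain ⟨x₀, hx₀K, hx₀⟩ := hKc.exists_isMaxOn ⟨a, haK⟩ hcont
  have hFx₀ : F a ≤ η x₀ * F x₀ := by
    have := hx₀ haK
    simpa [hηa] using this
  have hFpos : 0 < F x₀ := mul_pos (norm_pos_iff.2 (hne x₀ hx₀K)) (Real.exp_pos _)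
  have hηpos : 0 < η x₀ := pos_of_mul_pos_left (hFa.trans_le hFx₀) hFpos.le
  have hmax : ∀ x ∈ Metric.closedBall a R, η x * F x ≤ η x₀ * F x₀ := fun x hx => by
    by_cases hxK : F a ≤ Real.exp C * ‖gradient v x‖
    · exact hx₀ ⟨hx, hxK⟩
    · calc η x * F x ≤ 1 * F x := mul_le_mul_of_nonneg_right (hη1 x) (hF0 x)
        _ ≤ Real.exp C * ‖gradient v x‖ := by rw [one_mul]; exact hFC x
        _ ≤ F a := (not_le.1 hxK).le
        _ ≤ _ := hFx₀
  refine ⟨x₀, hne x₀ hx₀K, hηpos, ?_, ?_⟩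
  · have hlog : ∀ x, gradient v x ≠ 0 → 0 < η x → Real.log (η x * F x) = Real.log ‖gradient v x‖
        + Φ (m * v x + (k - 1) * Real.log ‖gradient v x‖) + Real.log (η x) := fun x hx hx' => by
      rw [Real.log_mul hx'.ne' (mul_pos (norm_pos_iff.2 hx) (Real.exp_pos _)).ne',
        Real.log_mul (norm_ne_zero_iff.2 hx) (Real.exp_pos _).ne', Real.log_exp]
      ring
    filter_upwards [hg.continuousAt.eventually_ne (hne x₀ hx₀K),
      hηc.continuousAt.eventually (lt_mem_nhds hηpos)] with x hx hx'
    rw [← hlog x hx hx', ← hlog x₀ (hne x₀ hx₀K) hηpos]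
    refine Real.log_le_log (mul_pos hx' (mul_pos (norm_pos_iff.2 hx) (Real.exp_pos _)))
      (hmax x ?_)
    have h1 : ‖x - a‖ ^ 2 < R ^ 2 := by
      have : 0 < 1 - ‖x - a‖ ^ 2 / R ^ 2 := hx'
      rwa [sub_pos, div_lt_one (by positivity)] at this
    rw [mem_closedBall_iff_norm]
    exact (lt_of_pow_lt_pow_left₀ 2 hR.le h1).le
  · calc F a ≤ η x₀ * F x₀ := hFx₀
      _ ≤ η x₀ * (Real.exp C * ‖gradient v x₀‖) := by gcongr; exact hFC x₀
      _ = _ := by ring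

theorem gradient_eq_zero_of_laplacian_eq [CompleteSpace E] (hdim : 2 ≤ Module.finrank ℝ E)
    {v : E → ℝ} {m k : ℝ} (hk : 1 / 2 ≤ k) (hv : ContDiff ℝ 2 v)
    (heq : ∀ x, Δ v x = -‖gradient v x‖ ^ 2 - ‖gradient v x‖ ^ (k + 1) * Real.exp (m * v x))
    (a : E) : gradient v a = 0 := by
  by_contra ha
  have hN : (0 : ℝ) < (Module.finrank ℝ E : ℝ) - 1 := by
    have : (2 : ℝ) ≤ Module.finrank ℝ E := by exact_mod_cast hdim
    linarith
  obtain ⟨S, d, c, hd, hc, Φ, hΦ⟩ := exists_isProfile m hk hN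
  obtain ⟨C, hC0, hC⟩ := exists_norm_gradient_sq_le_of_isLocalMax hdim hd hc hΦ
  obtain ⟨B, hB⟩ := hΦ.bddAbove
  set F := ‖gradient v a‖ * Real.exp (Φ (m * v a + (k - 1) * Real.log ‖gradient v a‖))
  have hF : 0 < F := mul_pos (norm_pos_iff.2 ha) (Real.exp_pos _)
  set M : ℝ := 2 * Module.finrank ℝ E + 4 + C * 4 with hM
  have hM0 : 0 ≤ M := by positivity
  have key : ∀ R : ℝ, 0 < R → F ^ 2 * R ^ 2 ≤ Real.exp B ^ 2 * (2 * M / c) := fun R hR => by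
    obtain ⟨x₀, hx₀, hη, hmax, hle⟩ :=
      exists_isMaxOn_cutoff (m := m) (k := k) hv hΦ.continuous hB ha hR
    obtain ⟨hζ, hζ1, hζ2⟩ := laplacian_log_cutoff_ge hR hη
    have h := hC hv heq hx₀ hζ hmax
    set e := 1 - ‖x₀ - a‖ ^ 2 / R ^ 2
    set A := ‖gradient v x₀‖
    have h1 : c / 2 * A ^ 2 ≤ M / (R * e) ^ 2 := by
      calc c / 2 * A ^ 2 ≤ _ := h
        _ ≤ (2 * Module.finrank ℝ E + 4) / (R * e) ^ 2 + C * (4 / (R * e) ^ 2) := by gcongr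
        _ = _ := by rw [hM]; ring
    rw [le_div_iff₀ (by positivity)] at h1
    calc F ^ 2 * R ^ 2 ≤ (Real.exp B * (A * e)) ^ 2 * R ^ 2 := by gcongr
      _ = Real.exp B ^ 2 * (2 / c * (c / 2 * A ^ 2 * (R * e) ^ 2)) := by field_simp
      _ ≤ Real.exp B ^ 2 * (2 / c * M) := by gcongr
      _ = _ := by ring
  set W := Real.exp B ^ 2 * (2 * M / c)
  have hW : 0 ≤ W := by positivity
  have h := key (1 + W / F ^ 2) (by positivity)
  have h2 : F ^ 2 * (1 + W / F ^ 2) = F ^ 2 + W := by field_simp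
  have h3 : F ^ 2 * (1 + W / F ^ 2) ≤ F ^ 2 * (1 + W / F ^ 2) ^ 2 := by
    gcongr
    refine le_self_pow₀ ?_ (by simp)
    have : 0 ≤ W / F ^ 2 := by positivity
    linarith
  have : 0 < F ^ 2 := by positivity
  linarith

theorem eq_of_laplacian_add_norm_gradient_rpow_eq_zero [CompleteSpace E]
    (hdim : 2 ≤ Module.finrank ℝ E) {u : E → ℝ} {p q : ℝ} (hq : 3 / 2 ≤ q) (hu : ContDiff ℝ 2 u)
    (hpos : ∀ x, 0 < u x) (heq : ∀ x, Δ u x + ‖gradient u x‖ ^ q * u x ^ p = 0) (x y : E) :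
    u x = u y := by
  have hv : ContDiff ℝ 2 (fun x => Real.log (u x)) := hu.log fun x => (hpos x).ne'
  have hgrad : ∀ x, gradient (fun x => Real.log (u x)) x = (u x)⁻¹ • gradient u x := fun x =>
    gradient_log (hu.differentiable (by simp) x) (hpos x).ne'
  have h0 := gradient_eq_zero_of_laplacian_eq hdim (k := q - 1) (m := p + q - 1) (by linarith) hv
    (fun x => by
      have hx := hpos x
      rw [laplacian_log hu.contDiffAt hx.ne', hgrad, norm_smul, norm_inv, Real.norm_eq_abs,
        abs_of_pos hx, sub_add_cancel, Real.mul_rpow (by positivity) (norm_nonneg _),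
        mul_comm (p + q - 1), ← Real.rpow_def_of_pos hx, Real.inv_rpow hx.le,
        ← Real.rpow_neg hx.le, eq_neg_of_add_eq_zero_left (heq x)]
      have e : u x ^ (-q) * u x ^ (p + q - 1) = u x ^ p / u x := by
        rw [← Real.rpow_add hx, ← Real.rpow_sub_one hx.ne']
        congr 1
        ring
      calc _ = -((u x)⁻¹ * ‖gradient u x‖) ^ 2 - ‖gradient u x‖ ^ q * (u x ^ p / u x) := by
            field_simp
            ring
        _ = _ := by
            rw [← e]
            ring)
  refine is_const_of_fderiv_eq_zero (𝕜 := ℝ) (hu.differentiable (by simp)) (fun z => ?_) x y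
  have h1 := (smul_eq_zero.1 ((hgrad z).symm.trans (h0 z))).resolve_left (inv_ne_zero (hpos z).ne')
  ext h
  rw [← inner_gradient_left, h1, inner_zero_left, zero_apply]

end Liouville

theorem elaplacian_eq_laplacian {n : ℕ} {u : EuclideanSpace ℝ (Fin n) → ℝ} (hu : ContDiff ℝ 2 u)
    (x : EuclideanSpace ℝ (Fin n)) : elaplacian u x = Δ u x := by
  unfold elaplacian
  rw [laplacian_eq_sum_fderiv_fderiv (EuclideanSpace.basisFun (Fin n) ℝ)]
  refine Finset.sum_congr rfl fun i _ => ?_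
  have hd : DifferentiableAt ℝ (fderiv ℝ u) x :=
    (hu.fderiv_right (m := 1) (by norm_num)).differentiable (by simp) x
  rw [fderiv_clm_apply hd (differentiableAt_const _)]
  simp

end

/-- **Theorem 1.1, case (2).** For `n ≥ 2`, `q ≥ 5/3` and `p ∈ ℝ`, every positive
classical solution of `Δu + |∇u|^q u^p = 0` on all of `ℝⁿ` is constant. -/
theorem liouville_q_ge_five_thirds (n : ℕ) (hn : 2 ≤ n) (p q : ℝ) (hq : 5 / 3 ≤ q)
    (u : EuclideanSpace ℝ (Fin n) → ℝ)
    (hu : ContDiff ℝ 2 u)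
    (hpos : ∀ x, 0 < u x)
    (heq : ∀ x, elaplacian u x + ‖gradient u x‖ ^ q * u x ^ p = 0) :
    ∀ x y, u x = u y := by
  exact eq_of_laplacian_add_norm_gradient_rpow_eq_zero (by simpa using hn) (q := q) (by linarith)
    hu hpos fun x => by rw [← elaplacian_eq_laplacian hu, heq]
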